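/- arXiv:1707.03033 — 2 statements merged into one kernel-verified Lean document; each statement's English description precedes it below -/
import Mathlib

section
/- Let A and H be Hopf algebras over a field k with H cocommutative. Suppose (A, ▶) is a left H^op-module bialgebra and (A, ▷) is a left H-module bialgebra such that x ▶ (x' ▷ a) = x' ▷ (x ▶ a) for all a ∈ A and x, x' ∈ H. Then the tensor product coalgebra A ⊗ H, equipped with the two multiplications (a ⊗ x)(b ⊗ y) = a(x₍₁₎ ▷ b) ⊗ x₍₂₎y and (a ⊗ x) ∘ (b ⊗ y) = a(x₍₁₎ ▶ b) ⊗ yx₍₂₎, is a Hopf brace. -/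
/-! Common definitions for formalizing "Constructing Hopf braces" (Agore). -/

open TensorProduct LinearMap

namespace HopfBraceNL

universe u

variable (k : Type u) [Field k]

section HopfStr

variable (V : Type u) [AddCommGroup V] [Module k V] [Coalgebra k V]

/-- The coalgebra `V` is cocommutative. -/
def IsCocomm : Prop :=
  (TensorProduct.comm k V V).toLinearMap ∘ₗ (Coalgebra.comul (R := k) (A := V)) =
    Coalgebra.comul (R := k) (A := V)

/-- A Hopf algebra structure on the underlying coalgebra of `V`: a multiplication, unit and
antipode making `V` a Hopf algebra whose comultiplication and counit are the given ones. -/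
structure HopfStr where
  mul : V ⊗[k] V →ₗ[k] V
  one : V
  mul_assoc : ∀ a b c : V, mul (mul (a ⊗ₜ[k] b) ⊗ₜ[k] c) = mul (a ⊗ₜ[k] mul (b ⊗ₜ[k] c))
  one_mul : ∀ a : V, mul (one ⊗ₜ[k] a) = a
  mul_one : ∀ a : V, mul (a ⊗ₜ[k] one) = a
  comul_mul : ∀ a b : V,
    Coalgebra.comul (R := k) (mul (a ⊗ₜ[k] b)) =
      TensorProduct.map mul mul
        (TensorProduct.tensorTensorTensorComm k V V V V
          (Coalgebra.comul (R := k) a ⊗ₜ[k] Coalgebra.comul (R := k) b))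
  counit_mul : ∀ a b : V,
    Coalgebra.counit (R := k) (mul (a ⊗ₜ[k] b)) =
      Coalgebra.counit (R := k) a * Coalgebra.counit (R := k) b
  comul_one : Coalgebra.comul (R := k) one = one ⊗ₜ[k] one
  counit_one : Coalgebra.counit (R := k) one = 1
  antipode : V →ₗ[k] V
  antipode_left :
    mul ∘ₗ rTensor V antipode ∘ₗ Coalgebra.comul =
      toSpanSingleton k V one ∘ₗ Coalgebra.counit
  antipode_right :
    mul ∘ₗ lTensor V antipode ∘ₗ Coalgebra.comul =
      toSpanSingleton k V one ∘ₗ Coalgebra.counit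

variable {k V}

/-- The Hopf structure is commutative. -/
def HopfStr.IsComm (hs : HopfStr k V) : Prop :=
  ∀ x y : V, hs.mul (x ⊗ₜ[k] y) = hs.mul (y ⊗ₜ[k] x)

/-- The linear map `x ⊗ y ⊗ z ↦ (x₍₁₎ ∘ y)·S(x₍₂₎)·(x₍₃₎ ∘ z)` (Sweedler notation), the right
hand side of the Hopf brace compatibility condition, written point-free.  Here `m` and `S` are
the multiplication and antipode of the first Hopf structure and `m'` the multiplication of the
second one. -/
noncomputable def braceRHS (m : V ⊗[k] V →ₗ[k] V) (S : V →ₗ[k] V)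
    (m' : V ⊗[k] V →ₗ[k] V) : V ⊗[k] (V ⊗[k] V) →ₗ[k] V :=
  m ∘ₗ lTensor V m
    ∘ₗ TensorProduct.map m' (TensorProduct.map S m')
    ∘ₗ lTensor (V ⊗[k] V) (TensorProduct.assoc k V V V).toLinearMap
    ∘ₗ (TensorProduct.tensorTensorTensorComm k V (V ⊗[k] V) V V).toLinearMap
    ∘ₗ rTensor (V ⊗[k] V)
        ((lTensor V (Coalgebra.comul (R := k))) ∘ₗ (Coalgebra.comul (R := k) (A := V)))

variable (k V) in
/-- A Hopf brace on the coalgebra `V`: two Hopf algebra structures subject to the compatibility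
`x ∘ (y·z) = (x₍₁₎ ∘ y)·S(x₍₂₎)·(x₍₃₎ ∘ z)`. -/
structure HopfBrace where
  dot : HopfStr k V
  circ : HopfStr k V
  brace : circ.mul ∘ₗ lTensor V dot.mul = braceRHS dot.mul dot.antipode circ.mul

/-- A solution of the braid equation on `V ⊗ V`. -/
def SolvesBraid {W : Type u} [AddCommGroup W] [Module k W]
    (c : W ⊗[k] W →ₗ[k] W ⊗[k] W) : Prop :=
  letI c₁ : (W ⊗[k] W) ⊗[k] W →ₗ[k] (W ⊗[k] W) ⊗[k] W := rTensor W c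
  letI c₂ : (W ⊗[k] W) ⊗[k] W →ₗ[k] (W ⊗[k] W) ⊗[k] W :=
    (TensorProduct.assoc k W W W).symm.toLinearMap ∘ₗ lTensor W c ∘ₗ
      (TensorProduct.assoc k W W W).toLinearMap
  c₁ ∘ₗ c₂ ∘ₗ c₁ = c₂ ∘ₗ c₁ ∘ₗ c₂

end HopfStr

section Actions

variable {k}
variable {A H : Type u}
  [AddCommGroup A] [Module k A] [Coalgebra k A]
  [AddCommGroup H] [Module k H] [Coalgebra k H]

/-- `(x, a) ↦ (x₍₁₎ ⊗ a₍₁₎) ⊗ (x₍₂₎ ⊗ a₍₂₎)`, as an element. -/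
noncomputable def split (x : H) (a : A) : (H ⊗[k] A) ⊗[k] (H ⊗[k] A) :=
  TensorProduct.tensorTensorTensorComm k H H A A
    (Coalgebra.comul (R := k) x ⊗ₜ[k] Coalgebra.comul (R := k) a)

/-- `A` is a left module over the Hopf structure `hH` via `act`. -/
structure IsLeftModule (hH : HopfStr k H) (act : H ⊗[k] A →ₗ[k] A) : Prop where
  one_act : ∀ a : A, act (hH.one ⊗ₜ[k] a) = a
  mul_act : ∀ (x y : H) (a : A),
    act (hH.mul (x ⊗ₜ[k] y) ⊗ₜ[k] a) = act (x ⊗ₜ[k] act (y ⊗ₜ[k] a))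

/-- `A` is a left module over `hH`-op via `act`, i.e. `(xy) ▶ a = y ▶ (x ▶ a)`. -/
structure IsLeftOpModule (hH : HopfStr k H) (act : H ⊗[k] A →ₗ[k] A) : Prop where
  one_act : ∀ a : A, act (hH.one ⊗ₜ[k] a) = a
  mul_act : ∀ (x y : H) (a : A),
    act (hH.mul (x ⊗ₜ[k] y) ⊗ₜ[k] a) = act (y ⊗ₜ[k] act (x ⊗ₜ[k] a))

/-- The measuring conditions: `x ▶ (ab) = (x₍₁₎ ▶ a)(x₍₂₎ ▶ b)` and `x ▶ 1 = ε(x)1`. -/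
structure IsModuleAlgebraLaw (hA : HopfStr k A) (act : H ⊗[k] A →ₗ[k] A) : Prop where
  act_mul : ∀ (x : H) (a b : A),
    act (x ⊗ₜ[k] hA.mul (a ⊗ₜ[k] b)) =
      hA.mul (TensorProduct.map act act
        (TensorProduct.tensorTensorTensorComm k H H A A
          (Coalgebra.comul (R := k) x ⊗ₜ[k] (a ⊗ₜ[k] b))))
  act_one : ∀ x : H, act (x ⊗ₜ[k] hA.one) = Coalgebra.counit (R := k) x • hA.one

/-- `act` is a coalgebra map: `Δ(x ▶ a) = (x₍₁₎ ▶ a₍₁₎) ⊗ (x₍₂₎ ▶ a₍₂₎)`,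
`ε(x ▶ a) = ε(x)ε(a)`. -/
structure IsCoalgebraLaw (act : H ⊗[k] A →ₗ[k] A) : Prop where
  comul_act : ∀ (x : H) (a : A),
    Coalgebra.comul (R := k) (act (x ⊗ₜ[k] a)) = TensorProduct.map act act (split x a)
  counit_act : ∀ (x : H) (a : A),
    Coalgebra.counit (R := k) (act (x ⊗ₜ[k] a)) =
      Coalgebra.counit (R := k) x * Coalgebra.counit (R := k) a

/-- `(A, act)` is a left `hH`-module algebra. -/
structure IsLeftModuleAlgebra (hH : HopfStr k H) (hA : HopfStr k A)
    (act : H ⊗[k] A →ₗ[k] A) : Prop where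
  toIsLeftModule : IsLeftModule hH act
  toLaw : IsModuleAlgebraLaw hA act

/-- `(A, act)` is a left `hH`-module coalgebra. -/
structure IsLeftModuleCoalgebra (hH : HopfStr k H) (act : H ⊗[k] A →ₗ[k] A) : Prop where
  toIsLeftModule : IsLeftModule hH act
  toCoalgLaw : IsCoalgebraLaw act

/-- `(A, act)` is a left `hH`-module bialgebra. -/
structure IsLeftModuleBialgebra (hH : HopfStr k H) (hA : HopfStr k A)
    (act : H ⊗[k] A →ₗ[k] A) : Prop where
  toIsLeftModule : IsLeftModule hH act
  toLaw : IsModuleAlgebraLaw hA act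
  toCoalgLaw : IsCoalgebraLaw act

/-- `(A, act)` is a left `hH`-op-module bialgebra. -/
structure IsLeftOpModuleBialgebra (hH : HopfStr k H) (hA : HopfStr k A)
    (act : H ⊗[k] A →ₗ[k] A) : Prop where
  toIsLeftOpModule : IsLeftOpModule hH act
  toLaw : IsModuleAlgebraLaw hA act
  toCoalgLaw : IsCoalgebraLaw act

/-- `H` is a right module over the Hopf structure `hA` via `ract : H ⊗ A → H`. -/
structure IsRightModule (hA : HopfStr k A) (ract : H ⊗[k] A →ₗ[k] H) : Prop where
  act_one : ∀ x : H, ract (x ⊗ₜ[k] hA.one) = x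
  act_mul : ∀ (x : H) (a b : A),
    ract (x ⊗ₜ[k] hA.mul (a ⊗ₜ[k] b)) = ract (ract (x ⊗ₜ[k] a) ⊗ₜ[k] b)

/-- `ract` is a coalgebra map `H ⊗ A → H`. -/
structure IsRightCoalgebraLaw (ract : H ⊗[k] A →ₗ[k] H) : Prop where
  comul_act : ∀ (x : H) (a : A),
    Coalgebra.comul (R := k) (ract (x ⊗ₜ[k] a)) = TensorProduct.map ract ract (split x a)
  counit_act : ∀ (x : H) (a : A),
    Coalgebra.counit (R := k) (ract (x ⊗ₜ[k] a)) =
      Coalgebra.counit (R := k) x * Coalgebra.counit (R := k) a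

/-- `(H, ract)` is a right `hA`-module bialgebra:  in addition to the module and coalgebra
conditions, `(xy) ◁ a = (x ◁ a₍₁₎)(y ◁ a₍₂₎)` and `1 ◁ a = ε(a)1`. -/
structure IsRightModuleBialgebra (hA : HopfStr k A) (hH : HopfStr k H)
    (ract : H ⊗[k] A →ₗ[k] H) : Prop where
  toIsRightModule : IsRightModule hA ract
  mul_ract : ∀ (x y : H) (a : A),
    ract (hH.mul (x ⊗ₜ[k] y) ⊗ₜ[k] a) =
      hH.mul (TensorProduct.map ract ract
        (TensorProduct.tensorTensorTensorComm k H H A A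
          ((x ⊗ₜ[k] y) ⊗ₜ[k] Coalgebra.comul (R := k) a)))
  one_ract : ∀ a : A, ract (hH.one ⊗ₜ[k] a) = Coalgebra.counit (R := k) a • hH.one
  toCoalgLaw : IsRightCoalgebraLaw ract

/-- `(A, H, tri, quad)` is a matched pair of Hopf algebras. -/
structure IsMatchedPair (hA : HopfStr k A) (hH : HopfStr k H)
    (tri : H ⊗[k] A →ₗ[k] A) (quad : H ⊗[k] A →ₗ[k] H) : Prop where
  tri_module : IsLeftModule hH tri
  tri_coalg : IsCoalgebraLaw tri
  quad_module : IsRightModule hA quad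
  quad_coalg : IsRightCoalgebraLaw quad
  mp1 : ∀ x : H, tri (x ⊗ₜ[k] hA.one) = Coalgebra.counit (R := k) x • hA.one
  mp1' : ∀ a : A, quad (hH.one ⊗ₜ[k] a) = Coalgebra.counit (R := k) a • hH.one
  mp2 : ∀ (x : H) (a b : A),
    tri (x ⊗ₜ[k] hA.mul (a ⊗ₜ[k] b)) =
      hA.mul (lTensor A tri (TensorProduct.assoc k A H A
        ((TensorProduct.map tri quad (split x a)) ⊗ₜ[k] b)))
  mp3 : ∀ (x y : H) (a : A),
    quad (hH.mul (x ⊗ₜ[k] y) ⊗ₜ[k] a) =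
      hH.mul (rTensor H quad ((TensorProduct.assoc k H A H).symm
        (x ⊗ₜ[k] TensorProduct.map tri quad (split y a))))
  mp4 : ∀ (x : H) (a : A),
    TensorProduct.map quad tri (split x a) =
      TensorProduct.comm k A H (TensorProduct.map tri quad (split x a))

variable (k) in
/-- `(a ⊗ (u₁ ⊗ u₂)) ⊗ y ↦ mA (a ⊗ u₁) ⊗ mH (u₂ ⊗ y)`: the standard way to assemble
a multiplication on `A ⊗ H` from a middle term `u ∈ A ⊗ H`. -/
noncomputable def sandwich (mA : A ⊗[k] A →ₗ[k] A) (mH : H ⊗[k] H →ₗ[k] H) :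
    (A ⊗[k] (A ⊗[k] H)) ⊗[k] H →ₗ[k] A ⊗[k] H :=
  TensorProduct.map mA mH
    ∘ₗ (TensorProduct.assoc k (A ⊗[k] A) H H).toLinearMap
    ∘ₗ rTensor H (TensorProduct.assoc k A A H).symm.toLinearMap

variable (k) in
/-- `(m ⊗ n) ⊗ p ↦ (m ⊗ p) ⊗ n`. -/
noncomputable def rightComm (M N P : Type u) [AddCommGroup M] [Module k M]
    [AddCommGroup N] [Module k N] [AddCommGroup P] [Module k P] :
    (M ⊗[k] N) ⊗[k] P →ₗ[k] (M ⊗[k] P) ⊗[k] N :=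
  (TensorProduct.assoc k M P N).symm.toLinearMap
    ∘ₗ lTensor M (TensorProduct.comm k N P).toLinearMap
    ∘ₗ (TensorProduct.assoc k M N P).toLinearMap

/-- `(x, b) ↦ (x₍₁₎ ▷ b₍₁₎) ⊗ (x₍₂₎ ◁ b₍₂₎)`. -/
noncomputable def matchedEl (tri : H ⊗[k] A →ₗ[k] A) (quad : H ⊗[k] A →ₗ[k] H)
    (x : H) (b : A) : A ⊗[k] H :=
  TensorProduct.map tri quad (split x b)

/-- `(x, b) ↦ (x₍₁₎ ▷ b) ⊗ x₍₂₎`. -/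
noncomputable def smashEl (tri : H ⊗[k] A →ₗ[k] A) (x : H) (b : A) : A ⊗[k] H :=
  rTensor H tri (rightComm k H H A (Coalgebra.comul (R := k) x ⊗ₜ[k] b))

/-- `(x, b) ↦ b₍₁₎ ⊗ (x ◁ b₍₂₎)`. -/
noncomputable def rsmashEl (ract : H ⊗[k] A →ₗ[k] H) (x : H) (b : A) : A ⊗[k] H :=
  lTensor A ract (TensorProduct.leftComm k H A A (x ⊗ₜ[k] Coalgebra.comul (R := k) b))

end Actions


section SmashProduct

open Coalgebra

variable {k}
variable {A H : Type u}
  [AddCommGroup A] [Module k A] [Coalgebra k A]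
  [AddCommGroup H] [Module k H] [Coalgebra k H]

lemma comul_tmul_eq (a : A) (x : H) :
    comul (R := k) (a ⊗ₜ[k] x) =
      tensorTensorTensorComm k A A H H (comul (R := k) a ⊗ₜ[k] comul (R := k) x) :=
  rfl

lemma IsCocomm.tensorTensorTensorComm_comul (h : IsCocomm k H) (x : H) :
    tensorTensorTensorComm k H H H H
        (TensorProduct.map comul comul (comul (R := k) x)) =
      TensorProduct.map comul comul (comul (R := k) x) := by
  have : Coalgebra.IsCocomm k H := ⟨h⟩
  exact (LinearMap.congr_fun (comulCoalgHom k H).map_comp_comul x).symm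

/-- The Hopf algebra structure with the opposite multiplication of a cocommutative one. -/
noncomputable def HopfStr.op (hH : HopfStr k H) (h : IsCocomm k H) : HopfStr k H where
  mul := hH.mul ∘ₗ (TensorProduct.comm k H H).toLinearMap
  one := hH.one
  mul_assoc a b c := by simp [hH.mul_assoc]
  one_mul a := by simp [hH.mul_one]
  mul_one a := by simp [hH.one_mul]
  comul_mul a b := by
    simp only [LinearMap.comp_apply, LinearEquiv.coe_coe, comm_tmul, hH.comul_mul]
    generalize comul (R := k) a = s
    generalize comul (R := k) b = t
    induction s with
    | zero => simp
    | add s₁ s₂ h₁ h₂ => simp [add_tmul, tmul_add, h₁, h₂]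
    | tmul u v =>
      induction t with
      | zero => simp
      | add s₁ s₂ h₁ h₂ => simp [add_tmul, tmul_add, h₁, h₂]
      | tmul u' v' => simp
  counit_mul a b := by simp [hH.counit_mul, mul_comm]
  comul_one := hH.comul_one
  counit_one := hH.counit_one
  antipode := hH.antipode
  antipode_left := by
    rw [← hH.antipode_right]
    ext x
    have hx : TensorProduct.comm k H H (comul (R := k) x) = comul (R := k) x :=
      LinearMap.congr_fun h x
    simp only [LinearMap.comp_apply]
    conv_rhs => rw [← hx]
    generalize comul (R := k) x = t
    induction t with
    | zero => simp
    | add s₁ s₂ h₁ h₂ => simp only [map_add, h₁, h₂]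
    | tmul u v => simp
  antipode_right := by
    rw [← hH.antipode_left]
    ext x
    have hx : TensorProduct.comm k H H (comul (R := k) x) = comul (R := k) x :=
      LinearMap.congr_fun h x
    simp only [LinearMap.comp_apply]
    conv_rhs => rw [← hx]
    generalize comul (R := k) x = t
    induction t with
    | zero => simp
    | add s₁ s₂ h₁ h₂ => simp only [map_add, h₁, h₂]
    | tmul u v => simp

lemma IsLeftOpModuleBialgebra.toOp {hH : HopfStr k H} {hA : HopfStr k A}
    {act : H ⊗[k] A →ₗ[k] A} (hop : IsLeftOpModuleBialgebra hH hA act) (h : IsCocomm k H) :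
    IsLeftModuleBialgebra (hH.op h) hA act where
  toIsLeftModule :=
    { one_act := hop.toIsLeftOpModule.one_act
      mul_act := fun x y a ↦ hop.toIsLeftOpModule.mul_act y x a }
  toLaw := hop.toLaw
  toCoalgLaw := hop.toCoalgLaw

/-- `u ⊗ v ↦ a (u ▷ b) ⊗ v y`, so that `(a ⊗ x)(b ⊗ y)` is the image of `Δ x`. -/
noncomputable def smashAux (mA : A ⊗[k] A →ₗ[k] A) (mH : H ⊗[k] H →ₗ[k] H)
    (act : H ⊗[k] A →ₗ[k] A) (a b : A) (y : H) : H ⊗[k] H →ₗ[k] A ⊗[k] H :=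
  TensorProduct.map (curry mA a ∘ₗ (curry act).flip b) ((curry mH).flip y)

@[simp]
lemma smashAux_tmul (mA : A ⊗[k] A →ₗ[k] A) (mH : H ⊗[k] H →ₗ[k] H)
    (act : H ⊗[k] A →ₗ[k] A) (a b : A) (y u v : H) :
    smashAux mA mH act a b y (u ⊗ₜ[k] v) =
      mA (a ⊗ₜ[k] act (u ⊗ₜ[k] b)) ⊗ₜ[k] mH (v ⊗ₜ[k] y) :=
  rfl

/-- The smash product multiplication `(a ⊗ x)(b ⊗ y) = a (x₍₁₎ ▷ b) ⊗ x₍₂₎ y`. -/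
noncomputable def smashMul (mA : A ⊗[k] A →ₗ[k] A) (mH : H ⊗[k] H →ₗ[k] H)
    (act : H ⊗[k] A →ₗ[k] A) : (A ⊗[k] H) ⊗[k] (A ⊗[k] H) →ₗ[k] A ⊗[k] H :=
  sandwich k mA mH
    ∘ₗ rTensor H (lTensor A (rTensor H act ∘ₗ rightComm k H H A ∘ₗ rTensor A comul))
    ∘ₗ rTensor H (TensorProduct.assoc k A H A).toLinearMap
    ∘ₗ (TensorProduct.assoc k (A ⊗[k] H) A H).symm.toLinearMap

lemma smashMul_tmul_eq_sandwich (mA : A ⊗[k] A →ₗ[k] A) (mH : H ⊗[k] H →ₗ[k] H)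
    (act : H ⊗[k] A →ₗ[k] A) (a b : A) (x y : H) :
    smashMul mA mH act ((a ⊗ₜ[k] x) ⊗ₜ[k] (b ⊗ₜ[k] y)) =
      sandwich k mA mH ((a ⊗ₜ[k] smashEl act x b) ⊗ₜ[k] y) :=
  rfl

lemma smashMul_tmul (mA : A ⊗[k] A →ₗ[k] A) (mH : H ⊗[k] H →ₗ[k] H)
    (act : H ⊗[k] A →ₗ[k] A) (a b : A) (x y : H) :
    smashMul mA mH act ((a ⊗ₜ[k] x) ⊗ₜ[k] (b ⊗ₜ[k] y)) =
      smashAux mA mH act a b y (comul x) := by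
  rw [smashMul_tmul_eq_sandwich, smashEl]
  induction comul (R := k) x with
  | zero => simp
  | add s₁ s₂ h₁ h₂ => simp only [map_add, tmul_add, add_tmul, h₁, h₂]
  | tmul u v => simp [sandwich, rightComm]

section ModuleBialgebra

variable {hA : HopfStr k A} {hH : HopfStr k H} {act : H ⊗[k] A →ₗ[k] A}

lemma smashMul_tmul_one_tmul (hact : IsLeftModuleBialgebra hH hA act) (a b : A) (y : H) :
    smashMul hA.mul hH.mul act ((a ⊗ₜ[k] hH.one) ⊗ₜ[k] (b ⊗ₜ[k] y)) =
      hA.mul (a ⊗ₜ[k] b) ⊗ₜ[k] y := by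
  simp [smashMul_tmul, hH.comul_one, hact.toIsLeftModule.one_act, hH.one_mul]

lemma smashMul_tmul_tmul_one (hact : IsLeftModuleBialgebra hH hA act) (a : A) (x y : H) :
    smashMul hA.mul hH.mul act ((a ⊗ₜ[k] x) ⊗ₜ[k] (hA.one ⊗ₜ[k] y)) =
      a ⊗ₜ[k] hH.mul (x ⊗ₜ[k] y) := by
  have key : ∀ t : H ⊗[k] H, smashAux hA.mul hH.mul act a hA.one y t =
      a ⊗ₜ[k] hH.mul (TensorProduct.lid k H (rTensor H counit t) ⊗ₜ[k] y) := fun t ↦ by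
    induction t with
    | zero => simp
    | add s₁ s₂ h₁ h₂ => simp only [map_add, tmul_add, add_tmul, h₁, h₂]
    | tmul u v => simp [hact.toLaw.act_one, hA.mul_one, smul_tmul]
  rw [smashMul_tmul, key]
  simp

lemma smashMul_assoc (hact : IsLeftModuleBialgebra hH hA act) (p q r : A ⊗[k] H) :
    smashMul hA.mul hH.mul act (smashMul hA.mul hH.mul act (p ⊗ₜ[k] q) ⊗ₜ[k] r) =
      smashMul hA.mul hH.mul act (p ⊗ₜ[k] smashMul hA.mul hH.mul act (q ⊗ₜ[k] r)) := by
  induction p with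
  | zero => simp
  | add p₁ p₂ h₁ h₂ => simp only [map_add, add_tmul, h₁, h₂]
  | tmul a x =>
  induction q with
  | zero => simp
  | add p₁ p₂ h₁ h₂ => simp only [map_add, add_tmul, tmul_add, h₁, h₂]
  | tmul b y =>
  induction r with
  | zero => simp
  | add p₁ p₂ h₁ h₂ => simp only [map_add, tmul_add, h₁, h₂]
  | tmul c z =>
  let R := Coalgebra.Repr.arbitrary k y
  let T : H → H → H ⊗[k] (H ⊗[k] H) →ₗ[k] A ⊗[k] H := fun p q ↦
    TensorProduct.map
      (hA.mul ∘ₗ TensorProduct.map (curry hA.mul a ∘ₗ (curry act).flip b)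
        ((curry act).flip (act (p ⊗ₜ[k] c))))
      ((curry hH.mul).flip (hH.mul (q ⊗ₜ[k] z))) ∘ₗ (TensorProduct.assoc k H H H).symm.toLinearMap
  have left : ∀ t : H ⊗[k] H, smashMul hA.mul hH.mul act
      (smashAux hA.mul hH.mul act a b y t ⊗ₜ[k] (c ⊗ₜ[k] z)) =
      ∑ j ∈ R.index, T (R.left j) (R.right j) (lTensor H comul t) := fun t ↦ by
    induction t with
    | zero => simp
    | add s₁ s₂ h₁ h₂ => simp only [map_add, add_tmul, h₁, h₂, Finset.sum_add_distrib]
    | tmul u v =>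
      rw [smashAux_tmul, smashMul_tmul, hH.comul_mul, lTensor_tmul, ← R.eq]
      induction comul (R := k) v with
      | zero => simp
      | add s₁ s₂ h₁ h₂ => simp only [map_add, add_tmul, tmul_add, h₁, h₂, Finset.sum_add_distrib]
      | tmul v w =>
        simp [T, tmul_sum, hA.mul_assoc, hH.mul_assoc, hact.toIsLeftModule.mul_act]
  have right : ∀ (j : H × H) (t : H ⊗[k] H),
      smashAux hA.mul hH.mul act a (hA.mul (b ⊗ₜ[k] act (R.left j ⊗ₜ[k] c)))
        (hH.mul (R.right j ⊗ₜ[k] z)) t =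
      T (R.left j) (R.right j) (TensorProduct.assoc k H H H (rTensor H comul t)) := fun j t ↦ by
    induction t with
    | zero => simp
    | add s₁ s₂ h₁ h₂ => simp only [map_add, h₁, h₂]
    | tmul u v =>
      rw [smashAux_tmul, hact.toLaw.act_mul, rTensor_tmul]
      induction comul (R := k) u with
      | zero => simp
      | add s₁ s₂ h₁ h₂ => simp only [map_add, add_tmul, tmul_add, h₁, h₂]
      | tmul v w => simp [T, hA.mul_assoc]
  rw [smashMul_tmul, left, smashMul_tmul, ← R.eq]
  simp only [map_sum, tmul_sum, smashAux_tmul, smashMul_tmul, right, coassoc_apply]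

lemma smashMul_comul_mul (h : IsCocomm k H) (hact : IsLeftModuleBialgebra hH hA act)
    (p q : A ⊗[k] H) :
    comul (R := k) (smashMul hA.mul hH.mul act (p ⊗ₜ[k] q)) =
      TensorProduct.map (smashMul hA.mul hH.mul act) (smashMul hA.mul hH.mul act)
        (tensorTensorTensorComm k _ _ _ _ (comul (R := k) p ⊗ₜ[k] comul (R := k) q)) := by
  induction p with
  | zero => simp
  | add p₁ p₂ h₁ h₂ => simp only [map_add, add_tmul, h₁, h₂]
  | tmul a x =>
  induction q with
  | zero => simp
  | add p₁ p₂ h₁ h₂ => simp only [map_add, tmul_add, h₁, h₂]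
  | tmul b y =>
  let Ra := Coalgebra.Repr.arbitrary k a
  let Rb := Coalgebra.Repr.arbitrary k b
  let Ry := Coalgebra.Repr.arbitrary k y
  let T : A × A → A × A → H × H → (H ⊗[k] H) ⊗[k] (H ⊗[k] H) →ₗ[k]
      (A ⊗[k] H) ⊗[k] (A ⊗[k] H) := fun i j l ↦
    TensorProduct.map
      (smashAux hA.mul hH.mul act (Ra.left i) (Rb.left j) (Ry.left l))
      (smashAux hA.mul hH.mul act (Ra.right i) (Rb.right j) (Ry.right l))
  have left : ∀ t : H ⊗[k] H, comul (R := k) (smashAux hA.mul hH.mul act a b y t) =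
      ∑ l ∈ Ry.index, ∑ j ∈ Rb.index, ∑ i ∈ Ra.index, T i j l
        (tensorTensorTensorComm k H H H H (TensorProduct.map comul comul t)) := fun t ↦ by
    induction t with
    | zero => simp
    | add s₁ s₂ h₁ h₂ => simp only [map_add, h₁, h₂, Finset.sum_add_distrib]
    | tmul u v =>
      rw [smashAux_tmul, comul_tmul_eq, hA.comul_mul, hact.toCoalgLaw.comul_act, split,
        hH.comul_mul, map_tmul, ← Ra.eq, ← Rb.eq, ← Ry.eq]
      induction comul (R := k) u with
      | zero => simp
      | add s₁ s₂ h₁ h₂ =>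
        simp only [map_add, add_tmul, tmul_add, h₁, h₂, Finset.sum_add_distrib]
      | tmul u u' =>
        induction comul (R := k) v with
        | zero => simp
        | add s₁ s₂ h₁ h₂ =>
          simp only [map_add, add_tmul, tmul_add, h₁, h₂, Finset.sum_add_distrib]
        | tmul v v' =>
          simp only [T, tmul_sum, sum_tmul, map_sum, tensorTensorTensorComm_tmul, map_tmul,
            smashAux_tmul]
  have right : ∀ (i j : A × A) (l : H × H) (t : H ⊗[k] H),
      TensorProduct.map (smashMul hA.mul hH.mul act) (smashMul hA.mul hH.mul act)
        (tensorTensorTensorComm k _ _ _ _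
          (tensorTensorTensorComm k _ _ _ _ ((Ra.left i ⊗ₜ[k] Ra.right i) ⊗ₜ[k] t) ⊗ₜ[k]
          ((Rb.left j ⊗ₜ[k] Ry.left l) ⊗ₜ[k] (Rb.right j ⊗ₜ[k] Ry.right l)))) =
      T i j l (TensorProduct.map comul comul t) := fun i j l t ↦ by
    induction t with
    | zero => simp
    | add s₁ s₂ h₁ h₂ => simp only [map_add, add_tmul, tmul_add, h₁, h₂]
    | tmul u v => simp [T, smashMul_tmul]
  rw [smashMul_tmul, left, h.tensorTensorTensorComm_comul, comul_tmul_eq, comul_tmul_eq,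
    ← Ra.eq, ← Rb.eq, ← Ry.eq]
  simp only [map_sum, tmul_sum, sum_tmul, tensorTensorTensorComm_tmul, right]

lemma counit_smashMul (hact : IsLeftModuleBialgebra hH hA act) (p q : A ⊗[k] H) :
    counit (R := k) (smashMul hA.mul hH.mul act (p ⊗ₜ[k] q)) =
      counit (R := k) p * counit (R := k) q := by
  induction p with
  | zero => simp
  | add p₁ p₂ h₁ h₂ => simp only [map_add, add_tmul, h₁, h₂, add_mul]
  | tmul a x =>
  induction q with
  | zero => simp
  | add p₁ p₂ h₁ h₂ => simp only [map_add, tmul_add, h₁, h₂, mul_add]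
  | tmul b y =>
  have key : ∀ t : H ⊗[k] H, counit (R := k) (smashAux hA.mul hH.mul act a b y t) =
      counit (R := k) a * counit (R := k) b * counit (R := k) y *
        counit (R := k) (TensorProduct.lid k H (rTensor H counit t)) := fun t ↦ by
    induction t with
    | zero => simp
    | add s₁ s₂ h₁ h₂ => simp only [map_add, h₁, h₂, mul_add]
    | tmul u v =>
      simp [hA.counit_mul, hH.counit_mul, hact.toCoalgLaw.counit_act]
      ring
  rw [smashMul_tmul, key]
  simp
  ring

variable (hA hH act) in
/-- The antipode `a ⊗ x ↦ (1 ⊗ S x)(S a ⊗ 1)` of the smash product. -/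
noncomputable def smashAntipode : A ⊗[k] H →ₗ[k] A ⊗[k] H :=
  smashMul hA.mul hH.mul act
    ∘ₗ TensorProduct.map (TensorProduct.mk k A H hA.one ∘ₗ hH.antipode)
      ((TensorProduct.mk k A H).flip hH.one ∘ₗ hA.antipode)
    ∘ₗ (TensorProduct.comm k A H).toLinearMap

lemma smashAntipode_tmul (a : A) (x : H) :
    smashAntipode hA hH act (a ⊗ₜ[k] x) = smashMul hA.mul hH.mul act
      ((hA.one ⊗ₜ[k] hH.antipode x) ⊗ₜ[k] (hA.antipode a ⊗ₜ[k] hH.one)) :=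
  rfl

lemma HopfStr.mul_rTensor_antipode_comul (x : H) :
    hH.mul (rTensor H hH.antipode (comul x)) = counit (R := k) x • hH.one :=
  LinearMap.congr_fun hH.antipode_left x

lemma HopfStr.mul_lTensor_antipode_comul (x : H) :
    hH.mul (lTensor H hH.antipode (comul x)) = counit (R := k) x • hH.one :=
  LinearMap.congr_fun hH.antipode_right x

lemma smashMul_smashAntipode_tmul_tmul (hact : IsLeftModuleBialgebra hH hA act) (a b c : A)
    (x y : H) :
    smashMul hA.mul hH.mul act (smashAntipode hA hH act (a ⊗ₜ[k] x) ⊗ₜ[k]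
      (hA.mul (b ⊗ₜ[k] c) ⊗ₜ[k] y)) = smashMul hA.mul hH.mul act
      ((hA.one ⊗ₜ[k] hH.antipode x) ⊗ₜ[k]
        (hA.mul (hA.mul (hA.antipode a ⊗ₜ[k] b) ⊗ₜ[k] c) ⊗ₜ[k] y)) := by
  rw [smashAntipode_tmul, smashMul_assoc hact, smashMul_tmul_one_tmul hact, hA.mul_assoc]

lemma smashAntipode_left (hact : IsLeftModuleBialgebra hH hA act) (p : A ⊗[k] H) :
    smashMul hA.mul hH.mul act (rTensor _ (smashAntipode hA hH act) (comul p)) =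
      counit (R := k) p • hA.one ⊗ₜ[k] hH.one := by
  induction p with
  | zero => simp
  | add p₁ p₂ h₁ h₂ => simp only [map_add, h₁, h₂, add_smul]
  | tmul a x =>
  have key : ∀ (s : A ⊗[k] A) (t : H ⊗[k] H),
      smashMul hA.mul hH.mul act (rTensor _ (smashAntipode hA hH act)
        (tensorTensorTensorComm k A A H H (s ⊗ₜ[k] t))) =
      smashMul hA.mul hH.mul act (TensorProduct.map
        (TensorProduct.mk k A H hA.one ∘ₗ hH.antipode)
        (TensorProduct.mk k A H (hA.mul (rTensor A hA.antipode s))) t) := fun s t ↦ by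
    induction t with
    | zero => simp
    | add s₁ s₂ h₁ h₂ => simp only [map_add, tmul_add, h₁, h₂]
    | tmul u v =>
    induction s with
    | zero => simp
    | add s₁ s₂ h₁ h₂ =>
      simp only [map_add, map_tmul, add_tmul, tmul_add, LinearMap.add_apply] at h₁ h₂ ⊢
      rw [h₁, h₂]
    | tmul a b =>
      have := smashMul_smashAntipode_tmul_tmul hact a b hA.one u v
      simpa [hA.mul_one] using this
  have key' : ∀ t : H ⊗[k] H,
      smashMul hA.mul hH.mul act (TensorProduct.map
        (TensorProduct.mk k A H hA.one ∘ₗ hH.antipode) (TensorProduct.mk k A H hA.one) t) =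
      hA.one ⊗ₜ[k] hH.mul (rTensor H hH.antipode t) := fun t ↦ by
    induction t with
    | zero => simp
    | add s₁ s₂ h₁ h₂ => simp only [map_add, tmul_add, h₁, h₂]
    | tmul u v => simp [smashMul_tmul_tmul_one hact]
  rw [comul_tmul_eq, key, hA.mul_rTensor_antipode_comul, map_smul, TensorProduct.map_smul_right,
    LinearMap.smul_apply, map_smul, key', hH.mul_rTensor_antipode_comul]
  simp [smul_smul, mul_comm]

lemma smashAntipode_right (hact : IsLeftModuleBialgebra hH hA act) (p : A ⊗[k] H) :
    smashMul hA.mul hH.mul act (lTensor _ (smashAntipode hA hH act) (comul p)) =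
      counit (R := k) p • hA.one ⊗ₜ[k] hH.one := by
  induction p with
  | zero => simp
  | add p₁ p₂ h₁ h₂ => simp only [map_add, h₁, h₂, add_smul]
  | tmul a x =>
  have key : ∀ (s : A ⊗[k] A) (t : H ⊗[k] H),
      smashMul hA.mul hH.mul act (lTensor _ (smashAntipode hA hH act)
        (tensorTensorTensorComm k A A H H (s ⊗ₜ[k] t))) =
      smashMul hA.mul hH.mul act (TensorProduct.map
        ((TensorProduct.mk k A H).flip (hH.mul (lTensor H hH.antipode t)))
        ((TensorProduct.mk k A H).flip hH.one ∘ₗ hA.antipode) s) := fun s t ↦ by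
    induction s with
    | zero => simp
    | add s₁ s₂ h₁ h₂ => simp only [map_add, add_tmul, h₁, h₂]
    | tmul a b =>
    induction t with
    | zero => simp
    | add s₁ s₂ h₁ h₂ =>
      simp only [map_add, map_tmul, add_tmul, tmul_add, LinearMap.add_apply] at h₁ h₂ ⊢
      rw [h₁, h₂]
    | tmul u v =>
      simp [smashAntipode_tmul, ← smashMul_assoc hact, smashMul_tmul_tmul_one hact]
  have key' : ∀ s : A ⊗[k] A,
      smashMul hA.mul hH.mul act (TensorProduct.map
        ((TensorProduct.mk k A H).flip hH.one)
        ((TensorProduct.mk k A H).flip hH.one ∘ₗ hA.antipode) s) =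
      hA.mul (lTensor A hA.antipode s) ⊗ₜ[k] hH.one := fun t ↦ by
    induction t with
    | zero => simp
    | add s₁ s₂ h₁ h₂ => simp only [map_add, add_tmul, h₁, h₂]
    | tmul u v => simp [smashMul_tmul_one_tmul hact]
  rw [comul_tmul_eq, key, hH.mul_lTensor_antipode_comul, map_smul, TensorProduct.map_smul_left,
    LinearMap.smul_apply, map_smul, key', hA.mul_lTensor_antipode_comul]
  simp [← smul_tmul', smul_smul]

lemma smashMul_one_tmul (hact : IsLeftModuleBialgebra hH hA act) (p : A ⊗[k] H) :
    smashMul hA.mul hH.mul act ((hA.one ⊗ₜ[k] hH.one) ⊗ₜ[k] p) = p := by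
  induction p with
  | zero => simp
  | add p₁ p₂ h₁ h₂ => simp only [map_add, tmul_add, h₁, h₂]
  | tmul a x => rw [smashMul_tmul_one_tmul hact, hA.one_mul]

variable (hA hH act) in
/-- The smash product Hopf algebra on `A ⊗ H`, for `H` cocommutative. -/
noncomputable def smashHopfStr (h : IsCocomm k H) (hact : IsLeftModuleBialgebra hH hA act) :
    HopfStr k (A ⊗[k] H) where
  mul := smashMul hA.mul hH.mul act
  one := hA.one ⊗ₜ[k] hH.one
  mul_assoc := smashMul_assoc hact
  one_mul := smashMul_one_tmul hact
  mul_one p := by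
    induction p with
    | zero => simp
    | add p₁ p₂ h₁ h₂ => simp only [map_add, add_tmul, h₁, h₂]
    | tmul a x => rw [smashMul_tmul_tmul_one hact, hH.mul_one]
  comul_mul := smashMul_comul_mul h hact
  counit_mul := counit_smashMul hact
  comul_one := by
    rw [comul_tmul_eq, hA.comul_one, hH.comul_one, tensorTensorTensorComm_tmul]
  counit_one := by simp [hA.counit_one, hH.counit_one]
  antipode := smashAntipode hA hH act
  antipode_left := LinearMap.ext (smashAntipode_left hact)
  antipode_right := LinearMap.ext (smashAntipode_right hact)

end ModuleBialgebra

section Brace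

variable {hA : HopfStr k A} {hH : HopfStr k H} {bact tri : H ⊗[k] A →ₗ[k] A}

/-- `S(X₍₁₎)·(X₍₂₎ ∘ Z)` for `X = 1 ⊗ x` is the image of `Δ x` under this map, where `M` and `M'`
are the multiplications `·` and `∘`. -/
noncomputable def antipodeMulCirc (hA : HopfStr k A) (hH : HopfStr k H)
    (M M' : (A ⊗[k] H) ⊗[k] (A ⊗[k] H) →ₗ[k] A ⊗[k] H) (Z : A ⊗[k] H) :
    H ⊗[k] H →ₗ[k] A ⊗[k] H :=
  M ∘ₗ TensorProduct.map (TensorProduct.mk k A H hA.one ∘ₗ hH.antipode)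
    ((curry M').flip Z ∘ₗ TensorProduct.mk k A H hA.one)

lemma braceRHS_tmul {V : Type u} [AddCommGroup V] [Module k V] [Coalgebra k V]
    (m : V ⊗[k] V →ₗ[k] V) (S : V →ₗ[k] V) (m' : V ⊗[k] V →ₗ[k] V) (x y z : V) :
    braceRHS m S m' (x ⊗ₜ[k] (y ⊗ₜ[k] z)) =
      m (TensorProduct.map ((curry m').flip y)
        (m ∘ₗ TensorProduct.map S ((curry m').flip z) ∘ₗ comul) (comul x)) := by
  simp only [braceRHS, LinearMap.comp_apply, rTensor_tmul]
  induction comul (R := k) x with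
  | zero => simp
  | add s₁ s₂ h₁ h₂ => simp only [map_add, add_tmul, h₁, h₂]
  | tmul u v =>
    simp only [lTensor_tmul, map_tmul, LinearMap.comp_apply]
    induction comul (R := k) v with
    | zero => simp
    | add s₁ s₂ h₁ h₂ => simp only [map_add, add_tmul, tmul_add, h₁, h₂]
    | tmul v w => simp

lemma smashMul_op_eq_smashMul (h : IsCocomm k H) (hmb : IsLeftModuleBialgebra hH hA tri)
    (a : A) (x : H) (Z : A ⊗[k] H) :
    smashMul hA.mul (hH.op h).mul bact ((a ⊗ₜ[k] x) ⊗ₜ[k] Z) =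
      smashMul hA.mul hH.mul tri ((a ⊗ₜ[k] hH.one) ⊗ₜ[k]
        smashMul hA.mul (hH.op h).mul bact ((hA.one ⊗ₜ[k] x) ⊗ₜ[k] Z)) := by
  induction Z with
  | zero => simp
  | add p₁ p₂ h₁ h₂ => simp only [map_add, tmul_add, h₁, h₂]
  | tmul c z =>
  rw [smashMul_tmul, smashMul_tmul]
  induction comul (R := k) x with
  | zero => simp
  | add s₁ s₂ h₁ h₂ => simp only [map_add, tmul_add, h₁, h₂]
  | tmul u v => simp [smashMul_tmul_one_tmul hmb, hA.one_mul]

lemma smashMul_op_eq_smashMul_map (h : IsCocomm k H) (hmb : IsLeftModuleBialgebra hH hA tri)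
    (a b : A) (x y : H) :
    smashMul hA.mul (hH.op h).mul bact ((a ⊗ₜ[k] x) ⊗ₜ[k] (b ⊗ₜ[k] y)) =
      smashMul hA.mul hH.mul tri (TensorProduct.map
        ((TensorProduct.mk k A H).flip y ∘ₗ curry hA.mul a ∘ₗ (curry bact).flip b)
        (TensorProduct.mk k A H hA.one) (comul x)) := by
  rw [smashMul_tmul]
  induction comul (R := k) x with
  | zero => simp
  | add s₁ s₂ h₁ h₂ => simp only [map_add, h₁, h₂]
  | tmul u v => simp [smashMul_tmul_tmul_one hmb, HopfStr.op]

lemma smashMul_map_smashAntipode_comul (h : IsCocomm k H)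
    (hmb : IsLeftModuleBialgebra hH hA tri) (a : A) (x : H) (Z : A ⊗[k] H) :
    smashMul hA.mul hH.mul tri (TensorProduct.map (smashAntipode hA hH tri)
        ((curry (smashMul hA.mul (hH.op h).mul bact)).flip Z) (comul (a ⊗ₜ[k] x))) =
      counit (R := k) a • antipodeMulCirc hA hH (smashMul hA.mul hH.mul tri)
        (smashMul hA.mul (hH.op h).mul bact) Z (comul x) := by
  have key : ∀ (s : A ⊗[k] A) (t : H ⊗[k] H),
      smashMul hA.mul hH.mul tri (TensorProduct.map (smashAntipode hA hH tri)
        ((curry (smashMul hA.mul (hH.op h).mul bact)).flip Z)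
        (tensorTensorTensorComm k A A H H (s ⊗ₜ[k] t))) =
      smashMul hA.mul hH.mul tri (TensorProduct.map
        (TensorProduct.mk k A H hA.one ∘ₗ hH.antipode)
        ((curry (smashMul hA.mul hH.mul tri)
          (hA.mul (rTensor A hA.antipode s) ⊗ₜ[k] hH.one)) ∘ₗ
          (curry (smashMul hA.mul (hH.op h).mul bact)).flip Z ∘ₗ TensorProduct.mk k A H hA.one)
        t) := fun s t ↦ by
    induction t with
    | zero => simp
    | add s₁ s₂ h₁ h₂ => simp only [map_add, tmul_add, h₁, h₂]
    | tmul u v =>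
    induction s with
    | zero => simp
    | add s₁ s₂ h₁ h₂ =>
      simp only [map_add, map_tmul, add_tmul, tmul_add, LinearMap.add_apply,
        LinearMap.comp_apply] at h₁ h₂ ⊢
      rw [h₁, h₂]
    | tmul a b =>
      simp only [tensorTensorTensorComm_tmul, map_tmul, LinearMap.flip_apply, curry_apply,
        LinearMap.comp_apply, rTensor_tmul, mk_apply, smashAntipode_tmul]
      rw [smashMul_op_eq_smashMul (tri := tri) h hmb b, smashMul_assoc hmb,
        ← smashMul_assoc hmb (hA.antipode a ⊗ₜ[k] hH.one), smashMul_tmul_one_tmul hmb]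
  rw [comul_tmul_eq, key, hA.mul_rTensor_antipode_comul, antipodeMulCirc, LinearMap.comp_apply]
  induction comul (R := k) x with
  | zero => simp
  | add s₁ s₂ h₁ h₂ => simp only [map_add, smul_add, h₁, h₂]
  | tmul u v =>
    simp [← smul_tmul', ← smashMul_op_eq_smashMul (tri := tri) h hmb]

lemma smashMul_map_antipodeMulCirc (hmb : IsLeftModuleBialgebra hH hA tri)
    (M' : (A ⊗[k] H) ⊗[k] (A ⊗[k] H) →ₗ[k] A ⊗[k] H) (x : H) (Z : A ⊗[k] H) :
    smashMul hA.mul hH.mul tri (TensorProduct.map (TensorProduct.mk k A H hA.one)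
        (antipodeMulCirc hA hH (smashMul hA.mul hH.mul tri) M' Z) (lTensor H comul (comul x))) =
      M' ((hA.one ⊗ₜ[k] x) ⊗ₜ[k] Z) := by
  have key : ∀ t : H ⊗[k] H,
      smashMul hA.mul hH.mul tri (TensorProduct.map (TensorProduct.mk k A H hA.one)
        (antipodeMulCirc hA hH (smashMul hA.mul hH.mul tri) M' Z)
          (TensorProduct.assoc k H H H (rTensor H comul t))) =
      M' ((hA.one ⊗ₜ[k] TensorProduct.lid k H (rTensor H counit t)) ⊗ₜ[k] Z) := fun t ↦ by
    induction t with
    | zero => simp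
    | add s₁ s₂ h₁ h₂ => simp only [map_add, tmul_add, add_tmul, h₁, h₂]
    | tmul u v =>
      have key' : ∀ s : H ⊗[k] H,
          smashMul hA.mul hH.mul tri (TensorProduct.map (TensorProduct.mk k A H hA.one)
            (antipodeMulCirc hA hH (smashMul hA.mul hH.mul tri) M' Z)
              (TensorProduct.assoc k H H H (s ⊗ₜ[k] v))) =
          smashMul hA.mul hH.mul tri ((hA.one ⊗ₜ[k] hH.mul (lTensor H hH.antipode s)) ⊗ₜ[k]
            M' ((hA.one ⊗ₜ[k] v) ⊗ₜ[k] Z)) := fun s ↦ by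
        induction s with
        | zero => simp
        | add s₁ s₂ h₁ h₂ => simp only [map_add, tmul_add, add_tmul, h₁, h₂]
        | tmul u u' =>
          simp [antipodeMulCirc, ← smashMul_assoc hmb, smashMul_tmul_tmul_one hmb]
      rw [rTensor_tmul, key', hH.mul_lTensor_antipode_comul]
      simp [← smul_tmul', smashMul_one_tmul hmb]
  rw [← coassoc_apply, key]
  simp

lemma smash_braceRHS (h : IsCocomm k H) (hmb : IsLeftModuleBialgebra hH hA tri)
    (a b : A) (x y : H) (Z : A ⊗[k] H) :
    braceRHS (smashMul hA.mul hH.mul tri) (smashAntipode hA hH tri)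
        (smashMul hA.mul (hH.op h).mul bact) ((a ⊗ₜ[k] x) ⊗ₜ[k] ((b ⊗ₜ[k] y) ⊗ₜ[k] Z)) =
      smashMul hA.mul hH.mul tri (TensorProduct.map
        ((TensorProduct.mk k A H).flip y ∘ₗ curry hA.mul a ∘ₗ (curry bact).flip b)
        ((curry (smashMul hA.mul (hH.op h).mul bact)).flip Z ∘ₗ TensorProduct.mk k A H hA.one)
        (comul x)) := by
  set M := smashMul hA.mul hH.mul tri with hM
  set M' := smashMul hA.mul (hH.op h).mul bact with hM'
  set J := antipodeMulCirc hA hH M M' Z with hJ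
  set N := (TensorProduct.mk k A H).flip y ∘ₗ curry hA.mul a ∘ₗ (curry bact).flip b with hN
  have reduce : ∀ (s : A ⊗[k] A) (t : H ⊗[k] H),
      M (TensorProduct.map ((curry M').flip (b ⊗ₜ[k] y))
        (M ∘ₗ TensorProduct.map (smashAntipode hA hH tri) ((curry M').flip Z) ∘ₗ comul)
        (tensorTensorTensorComm k A A H H (s ⊗ₜ[k] t))) =
      M (TensorProduct.map ((curry M').flip (b ⊗ₜ[k] y) ∘ₗ
        TensorProduct.mk k A H (TensorProduct.rid k A (lTensor A counit s))) (J ∘ₗ comul) t) :=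
      fun s t ↦ by
    induction t with
    | zero => simp
    | add s₁ s₂ h₁ h₂ => simp only [map_add, tmul_add, h₁, h₂]
    | tmul u v =>
    induction s with
    | zero => simp
    | add s₁ s₂ h₁ h₂ =>
      simp only [map_add, map_tmul, add_tmul, LinearMap.add_apply,
        LinearMap.comp_apply] at h₁ h₂ ⊢
      rw [h₁, h₂]
    | tmul a a' =>
      simp only [tensorTensorTensorComm_tmul, map_tmul, LinearMap.comp_apply]
      rw [smashMul_map_smashAntipode_comul h hmb, ← hM, ← hJ]
      simp [← smul_tmul']
  have split_left : ∀ t : H ⊗[k] H,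
      M (TensorProduct.map ((curry M').flip (b ⊗ₜ[k] y) ∘ₗ TensorProduct.mk k A H a)
        (J ∘ₗ comul) t) =
      M (TensorProduct.map N (M ∘ₗ TensorProduct.map (TensorProduct.mk k A H hA.one)
        (J ∘ₗ comul)) (TensorProduct.assoc k H H H (rTensor H comul t))) := fun t ↦ by
    induction t with
    | zero => simp
    | add s₁ s₂ h₁ h₂ => simp only [map_add, h₁, h₂]
    | tmul u v =>
      simp only [map_tmul, LinearMap.comp_apply, LinearMap.flip_apply, curry_apply, mk_apply,
        rTensor_tmul]
      rw [hM', smashMul_op_eq_smashMul_map (tri := tri) h hmb, ← hN, ← hM]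
      induction comul (R := k) u with
      | zero => simp
      | add s₁ s₂ h₁ h₂ => simp only [map_add, add_tmul, h₁, h₂]
      | tmul u u' =>
        simp only [map_tmul, assoc_tmul, LinearMap.comp_apply]
        rw [hM, smashMul_assoc hmb]
  have collapse : (M ∘ₗ TensorProduct.map (TensorProduct.mk k A H hA.one) (J ∘ₗ comul)) ∘ₗ comul =
      (curry M').flip Z ∘ₗ TensorProduct.mk k A H hA.one := by
    ext v
    have := smashMul_map_antipodeMulCirc hmb M' v Z
    rw [← LinearMap.comp_apply (TensorProduct.map _ _), map_comp_lTensor] at this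
    simpa using this
  rw [braceRHS_tmul, comul_tmul_eq, reduce, lTensor_counit_comul, rid_tmul, one_smul, split_left,
    coassoc_apply, ← LinearMap.comp_apply (TensorProduct.map _ _), map_comp_lTensor, collapse]

lemma smashMul_op_smashMul (h : IsCocomm k H) (hbact : IsLeftModuleBialgebra (hH.op h) hA bact)
    (hcom : ∀ (x x' : H) (a : A),
      bact (x ⊗ₜ[k] tri (x' ⊗ₜ[k] a)) = tri (x' ⊗ₜ[k] bact (x ⊗ₜ[k] a)))
    (a b c : A) (x y z : H) :
    smashMul hA.mul (hH.op h).mul bact ((a ⊗ₜ[k] x) ⊗ₜ[k]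
        smashMul hA.mul hH.mul tri ((b ⊗ₜ[k] y) ⊗ₜ[k] (c ⊗ₜ[k] z))) =
      smashMul hA.mul hH.mul tri (TensorProduct.map
        ((TensorProduct.mk k A H).flip y ∘ₗ curry hA.mul a ∘ₗ (curry bact).flip b)
        ((curry (smashMul hA.mul (hH.op h).mul bact)).flip (c ⊗ₜ[k] z) ∘ₗ
          TensorProduct.mk k A H hA.one)
        (comul x)) := by
  let R := Coalgebra.Repr.arbitrary k y
  let T : H → H → H ⊗[k] (H ⊗[k] H) →ₗ[k] A ⊗[k] H := fun p q ↦
    TensorProduct.map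
      (hA.mul ∘ₗ TensorProduct.map (curry hA.mul a ∘ₗ (curry bact).flip b)
        ((curry bact).flip (tri (p ⊗ₜ[k] c))))
      (curry hH.mul (hH.mul (q ⊗ₜ[k] z))) ∘ₗ (TensorProduct.assoc k H H H).symm.toLinearMap
  have left : ∀ (j : H × H) (t : H ⊗[k] H),
      smashAux hA.mul (hH.op h).mul bact a (hA.mul (b ⊗ₜ[k] tri (R.left j ⊗ₜ[k] c)))
        (hH.mul (R.right j ⊗ₜ[k] z)) t =
      T (R.left j) (R.right j) (TensorProduct.assoc k H H H (rTensor H comul t)) := fun j t ↦ by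
    induction t with
    | zero => simp
    | add s₁ s₂ h₁ h₂ => simp only [map_add, h₁, h₂]
    | tmul u v =>
      rw [smashAux_tmul, hbact.toLaw.act_mul, rTensor_tmul]
      induction comul (R := k) u with
      | zero => simp
      | add s₁ s₂ h₁ h₂ => simp only [map_add, add_tmul, tmul_add, h₁, h₂]
      | tmul v w => simp [T, hA.mul_assoc, HopfStr.op]
  have right : ∀ t : H ⊗[k] H, smashMul hA.mul hH.mul tri (TensorProduct.map
        ((TensorProduct.mk k A H).flip y ∘ₗ curry hA.mul a ∘ₗ (curry bact).flip b)
        ((curry (smashMul hA.mul (hH.op h).mul bact)).flip (c ⊗ₜ[k] z) ∘ₗ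
          TensorProduct.mk k A H hA.one) t) =
      ∑ j ∈ R.index, T (R.left j) (R.right j) (lTensor H comul t) := fun t ↦ by
    induction t with
    | zero => simp
    | add s₁ s₂ h₁ h₂ => simp only [map_add, h₁, h₂, Finset.sum_add_distrib]
    | tmul u v =>
      simp only [map_tmul, LinearMap.comp_apply, LinearMap.flip_apply, curry_apply, mk_apply,
        lTensor_tmul, smashMul_tmul hA.mul (hH.op h).mul]
      induction comul (R := k) v with
      | zero => simp
      | add s₁ s₂ h₁ h₂ => simp only [map_add, tmul_add, h₁, h₂, Finset.sum_add_distrib]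
      | tmul v w =>
        rw [smashAux_tmul, smashMul_tmul, ← R.eq]
        simp [T, HopfStr.op, hA.one_mul, hH.mul_assoc, hcom]
  rw [right, smashMul_tmul, ← R.eq]
  simp only [map_sum, tmul_sum, smashAux_tmul, smashMul_tmul, left, coassoc_apply]

variable (hA hH bact tri) in
/-- The Hopf brace on `A ⊗ H` built from two commuting actions, `bact` of `H`-op and `tri` of `H`. -/
noncomputable def smashHopfBrace (h : IsCocomm k H) (hop : IsLeftOpModuleBialgebra hH hA bact)
    (hmb : IsLeftModuleBialgebra hH hA tri)
    (hcom : ∀ (x x' : H) (a : A),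
      bact (x ⊗ₜ[k] tri (x' ⊗ₜ[k] a)) = tri (x' ⊗ₜ[k] bact (x ⊗ₜ[k] a))) :
    HopfBrace k (A ⊗[k] H) where
  dot := smashHopfStr hA hH tri h hmb
  circ := smashHopfStr hA (hH.op h) bact h (hop.toOp h)
  brace := by
    refine TensorProduct.ext' fun p w ↦ ?_
    induction p with
    | zero => simp
    | add p₁ p₂ h₁ h₂ => simp only [map_add, add_tmul, h₁, h₂]
    | tmul a x =>
    induction w with
    | zero => simp
    | add p₁ p₂ h₁ h₂ => simp only [map_add, tmul_add, h₁, h₂]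
    | tmul q r =>
    induction q with
    | zero => simp
    | add p₁ p₂ h₁ h₂ => simp only [map_add, tmul_add, add_tmul, h₁, h₂]
    | tmul b y =>
    induction r with
    | zero => simp
    | add p₁ p₂ h₁ h₂ => simp only [map_add, tmul_add, h₁, h₂]
    | tmul c z =>
    exact (smashMul_op_smashMul h (hop.toOp h) hcom a b c x y z).trans
      (smash_braceRHS h hmb a b x y (c ⊗ₜ[k] z)).symm

end Brace

end SmashProduct

/-- Corollary `22.22`. Let `A`, `H` be Hopf algebras with `H` cocommutative.
If `(A, ▶)` is a left `H^op`-module bialgebra and `(A, ▷)` is a left `H`-module bialgebra such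
that `x ▶ (x' ▷ a) = x' ▷ (x ▶ a)`, then the tensor product coalgebra `A ⊗ H` with
`(a ⊗ x)(b ⊗ y) = a(x₍₁₎ ▷ b) ⊗ x₍₂₎y` and `(a ⊗ x) ∘ (b ⊗ y) = a(x₍₁₎ ▶ b) ⊗ yx₍₂₎`
is a Hopf brace. -/
theorem statement5 {k : Type u} [Field k]
    {A H : Type u} [AddCommGroup A] [Module k A] [Coalgebra k A]
    [AddCommGroup H] [Module k H] [Coalgebra k H]
    (hA : HopfStr k A) (hH : HopfStr k H) (hHcocomm : IsCocomm k H)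
    (bact : H ⊗[k] A →ₗ[k] A) (tri : H ⊗[k] A →ₗ[k] A)
    (hop : IsLeftOpModuleBialgebra hH hA bact)
    (hmb : IsLeftModuleBialgebra hH hA tri)
    (hcom : ∀ (x x' : H) (a : A),
      bact (x ⊗ₜ[k] tri (x' ⊗ₜ[k] a)) = tri (x' ⊗ₜ[k] bact (x ⊗ₜ[k] a))) :
    ∃ B : HopfBrace k (A ⊗[k] H),
      (∀ (a b : A) (x y : H),
        B.dot.mul ((a ⊗ₜ[k] x) ⊗ₜ[k] (b ⊗ₜ[k] y)) =
          sandwich k hA.mul hH.mul ((a ⊗ₜ[k] smashEl tri x b) ⊗ₜ[k] y)) ∧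
      (∀ (a b : A) (x y : H),
        B.circ.mul ((a ⊗ₜ[k] x) ⊗ₜ[k] (b ⊗ₜ[k] y)) =
          sandwich k hA.mul (hH.mul ∘ₗ (TensorProduct.comm k H H).toLinearMap)
            ((a ⊗ₜ[k] smashEl bact x b) ⊗ₜ[k] y)) :=
  ⟨smashHopfBrace hA hH bact tri hHcocomm hop hmb hcom,
    fun _ _ _ _ ↦ rfl, fun _ _ _ _ ↦ rfl⟩

end HopfBraceNL
end

section
/- Let A and H be Hopf algebras over a field k with H cocommutative, and let (A, ▶) be a left H^op-module bialgebra. Then the tensor product coalgebra A ⊗ H, equipped with the two multiplications (a ⊗ x)(b ⊗ y) = ab ⊗ xy and (a ⊗ x) ∘ (b ⊗ y) = a(x₍₁₎ ▶ b) ⊗ yx₍₂₎, is a Hopf brace; it is cocommutative if A is cocommutative. -/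
/-! Common definitions for formalizing "Constructing Hopf braces" (Agore). -/

open TensorProduct LinearMap

namespace HopfBraceNL

universe u

variable (k : Type u) [Field k]

section Sweedler

attribute [fun_prop] IsLinearMap

variable {k}
variable {C D M N P Q : Type u}
  [AddCommGroup C] [Module k C] [Coalgebra k C]
  [AddCommGroup D] [Module k D] [Coalgebra k D]
  [AddCommGroup M] [Module k M] [AddCommGroup N] [Module k N] [AddCommGroup P] [Module k P]
  [AddCommGroup Q] [Module k Q]

@[fun_prop]
theorem isLinearMap_fun_id : IsLinearMap k (fun x : M => x) := ⟨fun _ _ => rfl, fun _ _ => rfl⟩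

@[fun_prop]
theorem isLinearMap_fun_comp {f : N → P} {g : M → N} (hf : IsLinearMap k f)
    (hg : IsLinearMap k g) : IsLinearMap k (fun x => f (g x)) :=
  ⟨fun x y => by rw [hg.map_add, hf.map_add], fun c x => by rw [hg.map_smul, hf.map_smul]⟩

@[fun_prop]
theorem isLinearMap_apply (L : N →ₗ[k] P) {g : M → N} (hg : IsLinearMap k g) :
    IsLinearMap k (fun x => L (g x)) :=
  ⟨fun x y => by rw [hg.map_add, map_add], fun c x => by rw [hg.map_smul, map_smul]⟩

@[fun_prop]
theorem isLinearMap_tmul_left {g : M → N} (hg : IsLinearMap k g) (p : P) :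
    IsLinearMap k (fun x => g x ⊗ₜ[k] p) :=
  ⟨fun x y => by rw [hg.map_add, add_tmul], fun c x => by rw [hg.map_smul, smul_tmul']⟩

@[fun_prop]
theorem isLinearMap_tmul_right {g : M → N} (hg : IsLinearMap k g) (p : P) :
    IsLinearMap k (fun x => p ⊗ₜ[k] g x) :=
  ⟨fun x y => by rw [hg.map_add, tmul_add], fun c x => by rw [hg.map_smul, tmul_smul]⟩

@[fun_prop]
theorem isLinearMap_smul_left {g : M → k} (hg : IsLinearMap k g) (p : P) :
    IsLinearMap k (fun x => g x • p) :=
  ⟨fun x y => by rw [hg.map_add, add_smul], fun c x => by rw [hg.map_smul, smul_assoc]⟩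

@[fun_prop]
theorem isLinearMap_smul_right {g : M → N} (hg : IsLinearMap k g) (c : k) :
    IsLinearMap k (fun x => c • g x) :=
  ⟨fun x y => by rw [hg.map_add, smul_add], fun d x => by rw [hg.map_smul, smul_comm]⟩

/-- The Sweedler sum `F x₍₁₎ x₍₂₎`. -/
noncomputable def sw (x : C) (F : C → C → M) : M :=
  ∑ i ∈ (Coalgebra.Repr.arbitrary k x).index,
    F ((Coalgebra.Repr.arbitrary k x).left i) ((Coalgebra.Repr.arbitrary k x).right i)

theorem apply_comul (L : C ⊗[k] C →ₗ[k] M) (x : C) :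
    L (Coalgebra.comul (R := k) x) = sw (k := k) x fun p q => L (p ⊗ₜ[k] q) := by
  rw [← (Coalgebra.Repr.arbitrary k x).eq, map_sum]; rfl

theorem comul_eq_sw (x : C) :
    Coalgebra.comul (R := k) x = sw (k := k) x fun p q => p ⊗ₜ[k] q :=
  apply_comul LinearMap.id x

/-- A function linear in each of two variables, as a linear map on the tensor product. -/
noncomputable def bilift (F : M → N → P) (h₁ : ∀ q, IsLinearMap k fun p => F p q)
    (h₂ : ∀ p, IsLinearMap k fun q => F p q) : M ⊗[k] N →ₗ[k] P :=
  TensorProduct.lift (LinearMap.mk₂ k F (fun a b c => (h₁ c).map_add a b)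
    (fun c a b => (h₁ b).map_smul c a) (fun a => (h₂ a).map_add) (fun c a => (h₂ a).map_smul c))

theorem sw_eq_bilift (x : C) (F : C → C → M) (h₁ : ∀ q, IsLinearMap k fun p => F p q)
    (h₂ : ∀ p, IsLinearMap k fun q => F p q) :
    sw (k := k) x F = bilift F h₁ h₂ (Coalgebra.comul (R := k) x) := by
  rw [apply_comul]; rfl

@[fun_prop]
theorem isLinearMap_sw_elem {g : N → C} (hg : IsLinearMap k g) (F : C → C → M)
    (h₁ : ∀ q, IsLinearMap k fun p => F p q) (h₂ : ∀ p, IsLinearMap k fun q => F p q) :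
    IsLinearMap k (fun y => sw (k := k) (g y) F) := by
  simp only [sw_eq_bilift _ F h₁ h₂]
  fun_prop

@[fun_prop]
theorem isLinearMap_sw_fun (x : C) {F : N → C → C → M}
    (h : ∀ p q, IsLinearMap k fun y => F y p q) :
    IsLinearMap k (fun y => sw (k := k) x (F y)) :=
  ⟨fun y z => by simp only [sw, (h _ _).map_add, Finset.sum_add_distrib],
    fun c y => by simp only [sw, (h _ _).map_smul, Finset.smul_sum]⟩

theorem sw_congr {M : Type u} [AddCommGroup M] {x : C} {F G : C → C → M} (h : ∀ p q, F p q = G p q) :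
    sw (k := k) x F = sw (k := k) x G := by
  simp only [sw, h]

theorem map_sw {f : M → N} (hf : IsLinearMap k f) (x : C) (F : C → C → M) :
    f (sw (k := k) x F) = sw (k := k) x fun p q => f (F p q) :=
  map_sum (IsLinearMap.mk' f hf) _ _

theorem sw_swap {M : Type u} [AddCommGroup M] (x : C) (y : D)
    (F : C → C → D → D → M) :
    (sw (k := k) x fun p q => sw (k := k) y fun r s => F p q r s) =
      sw (k := k) y fun r s => sw (k := k) x fun p q => F p q r s :=
  Finset.sum_comm

theorem sw_coassoc_tmul (x : C) :
    (sw (k := k) x fun p q => sw (k := k) p fun r s => r ⊗ₜ[k] (s ⊗ₜ[k] q)) =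
      sw (k := k) x fun p q => sw (k := k) q fun r s => p ⊗ₜ[k] (r ⊗ₜ[k] s) := by
  have h := Coalgebra.coassoc_apply (R := k) x
  rw [← LinearEquiv.coe_coe, ← LinearMap.comp_apply, apply_comul, apply_comul] at h
  simp only [LinearMap.comp_apply, rTensor_tmul, lTensor_tmul, LinearEquiv.coe_coe,
    comul_eq_sw] at h
  simpa only [sw, sum_tmul, tmul_sum, map_sum, TensorProduct.assoc_tmul] using h

/-- A function linear in each of three variables, as a linear map on the tensor product. -/
noncomputable def trilift (F : M → N → P → Q) (h₁ : ∀ q r, IsLinearMap k fun p => F p q r)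
    (h₂ : ∀ p r, IsLinearMap k fun q => F p q r) (h₃ : ∀ p q, IsLinearMap k fun r => F p q r) :
    M ⊗[k] (N ⊗[k] P) →ₗ[k] Q :=
  bilift (fun p t => bilift (F p) (h₂ p) (h₃ p) t)
    (fun t => by
      induction t using TensorProduct.induction_on with
      | zero => exact ⟨fun _ _ => by simp only [map_zero, add_zero],
          fun _ _ => by simp only [map_zero, smul_zero]⟩
      | tmul q r => exact h₁ q r
      | add s t hs ht =>
        refine ⟨fun a b => ?_, fun c a => ?_⟩
        · rw [map_add, map_add, map_add, hs.map_add, ht.map_add, add_add_add_comm]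
        · rw [map_add, map_add, hs.map_smul, ht.map_smul, smul_add])
    (fun p => ⟨map_add _, map_smul _⟩)

theorem sw_coassoc (x : C) (F : C → C → C → M)
    (h₁ : ∀ q r, IsLinearMap k fun p => F p q r := by fun_prop)
    (h₂ : ∀ p r, IsLinearMap k fun q => F p q r := by fun_prop)
    (h₃ : ∀ p q, IsLinearMap k fun r => F p q r := by fun_prop) :
    (sw (k := k) x fun p q => sw (k := k) p fun r s => F r s q) =
      sw (k := k) x fun p q => sw (k := k) q fun r s => F p r s := by
  have h := congrArg (trilift F h₁ h₂ h₃) (sw_coassoc_tmul (k := k) x)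
  simp only [sw, map_sum] at h
  exact h

theorem sw_counit_left (x : C) (F : C → M) (h : IsLinearMap k F := by fun_prop) :
    (sw (k := k) x fun p q => Coalgebra.counit (R := k) p • F q) = F x := by
  simp only [← h.map_smul]
  rw [← map_sw h]
  exact congrArg F (Coalgebra.sum_counit_smul _)

theorem sw_comm (hC : IsCocomm k C) (x : C) (F : C → C → M)
    (h₁ : ∀ q, IsLinearMap k fun p => F p q := by fun_prop)
    (h₂ : ∀ p, IsLinearMap k fun q => F p q := by fun_prop) :
    sw (k := k) x F = sw (k := k) x fun p q => F q p := by
  rw [sw_eq_bilift x F h₁ h₂, ← LinearMap.congr_fun hC x, LinearMap.comp_apply,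
    ← LinearMap.comp_apply, apply_comul]
  rfl

theorem sw_counit_right (x : C) (F : C → M) (h : IsLinearMap k F := by fun_prop) :
    (sw (k := k) x fun p q => Coalgebra.counit (R := k) q • F p) = F x := by
  have h' := congrArg (TensorProduct.lift ((LinearMap.lsmul k M).flip.comp (IsLinearMap.mk' F h)))
    (Coalgebra.lTensor_counit_comul (R := k) x)
  rw [← LinearMap.comp_apply, apply_comul] at h'
  simpa using h'

theorem sw_tmul (a : C) (x : D) (F : C ⊗[k] D → C ⊗[k] D → M)
    (h₁ : ∀ q, IsLinearMap k fun p => F p q := by fun_prop)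
    (h₂ : ∀ p, IsLinearMap k fun q => F p q := by fun_prop) :
    sw (k := k) (a ⊗ₜ[k] x) F = sw (k := k) a fun p q => sw (k := k) x fun r s =>
      F (p ⊗ₜ[k] r) (q ⊗ₜ[k] s) := by
  rw [sw_eq_bilift _ F h₁ h₂, TensorProduct.comul_tmul, comul_eq_sw a, comul_eq_sw x]
  simp only [sw, sum_tmul, tmul_sum, map_sum]
  rw [Finset.sum_comm]
  rfl

theorem apply_tensorTensorTensorComm_comul (L : (C ⊗[k] D) ⊗[k] (C ⊗[k] D) →ₗ[k] M)
    (x : C) (a : D) :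
    L (TensorProduct.tensorTensorTensorComm k C C D D
      (Coalgebra.comul (R := k) x ⊗ₜ[k] Coalgebra.comul (R := k) a)) =
    sw (k := k) x fun p q => sw (k := k) a fun r s => L ((p ⊗ₜ[k] r) ⊗ₜ[k] (q ⊗ₜ[k] s)) := by
  rw [comul_eq_sw a, comul_eq_sw x]
  simp only [sw, sum_tmul, tmul_sum, map_sum]
  rw [Finset.sum_comm]
  rfl

theorem eq_of_forall_tmul {f g : M ⊗[k] N → P} (hf : IsLinearMap k f) (hg : IsLinearMap k g)
    (h : ∀ a x, f (a ⊗ₜ[k] x) = g (a ⊗ₜ[k] x)) (t : M ⊗[k] N) : f t = g t :=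
  LinearMap.congr_fun (TensorProduct.ext' h : IsLinearMap.mk' f hf = IsLinearMap.mk' g hg) t

end Sweedler

section Hopf

variable {k}
variable {A H M N : Type u}
  [AddCommGroup A] [Module k A] [Coalgebra k A]
  [AddCommGroup H] [Module k H] [Coalgebra k H]
  [AddCommGroup M] [Module k M] [AddCommGroup N] [Module k N]

theorem sw_middle_comm (hH : IsCocomm k H) (x : H) (G : H → H → H → H → M)
    (h₁ : ∀ b c d, IsLinearMap k fun a => G a b c d := by fun_prop)
    (h₂ : ∀ a c d, IsLinearMap k fun b => G a b c d := by fun_prop)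
    (h₃ : ∀ a b d, IsLinearMap k fun c => G a b c d := by fun_prop)
    (h₄ : ∀ a b c, IsLinearMap k fun d => G a b c d := by fun_prop) :
    (sw (k := k) x fun p q => sw (k := k) p fun a b => sw (k := k) q fun c d => G a b c d) =
      sw (k := k) x fun p q => sw (k := k) p fun a b => sw (k := k) q fun c d => G a c b d := by
  rw [sw_coassoc x fun a b q => sw (k := k) q fun c d => G a b c d,
    sw_coassoc x fun a b q => sw (k := k) q fun c d => G a c b d]
  refine sw_congr fun a t => ?_
  rw [← sw_coassoc t fun b c d => G a b c d, ← sw_coassoc t fun b c d => G a c b d]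
  exact sw_congr fun e d => sw_comm hH e fun b c => G a b c d

namespace HopfStr

theorem sw_mul (hs : HopfStr k H) (x y : H) (F : H → H → M)
    (h₁ : ∀ q, IsLinearMap k fun p => F p q := by fun_prop)
    (h₂ : ∀ p, IsLinearMap k fun q => F p q := by fun_prop) :
    sw (k := k) (hs.mul (x ⊗ₜ[k] y)) F = sw (k := k) x fun p q => sw (k := k) y fun r s =>
      F (hs.mul (p ⊗ₜ[k] r)) (hs.mul (q ⊗ₜ[k] s)) := by
  rw [sw_eq_bilift _ F h₁ h₂, hs.comul_mul, ← LinearMap.comp_apply,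
    apply_tensorTensorTensorComm_comul]
  rfl

theorem sw_one (hs : HopfStr k H) (F : H → H → M)
    (h₁ : ∀ q, IsLinearMap k fun p => F p q := by fun_prop)
    (h₂ : ∀ p, IsLinearMap k fun q => F p q := by fun_prop) :
    sw (k := k) hs.one F = F hs.one hs.one := by
  rw [sw_eq_bilift _ F h₁ h₂, hs.comul_one]
  rfl

theorem sw_antipode_left (hs : HopfStr k H) (x : H) (F : H → M)
    (h : IsLinearMap k F := by fun_prop) :
    (sw (k := k) x fun p q => F (hs.mul (hs.antipode p ⊗ₜ[k] q))) =
      Coalgebra.counit (R := k) x • F hs.one := by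
  have h' := LinearMap.congr_fun hs.antipode_left x
  simp only [LinearMap.comp_apply, toSpanSingleton_apply] at h'
  rw [← map_sw h, ← h.map_smul, ← h', ← LinearMap.comp_apply, apply_comul]
  rfl

theorem sw_antipode_right (hs : HopfStr k H) (x : H) (F : H → M)
    (h : IsLinearMap k F := by fun_prop) :
    (sw (k := k) x fun p q => F (hs.mul (p ⊗ₜ[k] hs.antipode q))) =
      Coalgebra.counit (R := k) x • F hs.one := by
  have h' := LinearMap.congr_fun hs.antipode_right x
  simp only [LinearMap.comp_apply, toSpanSingleton_apply] at h'
  rw [← map_sw h, ← h.map_smul, ← h', ← LinearMap.comp_apply, apply_comul]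
  rfl

theorem counit_antipode (hs : HopfStr k H) (x : H) :
    Coalgebra.counit (R := k) (hs.antipode x) = Coalgebra.counit (R := k) x := by
  have h := hs.sw_antipode_left x fun y => Coalgebra.counit (R := k) y
  simp only [hs.counit_mul, hs.counit_one, smul_eq_mul, _root_.mul_one] at h
  rw [← h]
  simp only [mul_comm (Coalgebra.counit (R := k) (hs.antipode _)), ← smul_eq_mul]
  exact (sw_counit_right x fun y => Coalgebra.counit (R := k) (hs.antipode y)).symm

theorem sw_mul_antipode (hs : HopfStr k H) (hH : IsCocomm k H) (x : H) (F : H → H → M)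
    (h₁ : ∀ q, IsLinearMap k fun p => F p q := by fun_prop)
    (h₂ : ∀ p, IsLinearMap k fun q => F p q := by fun_prop) :
    (sw (k := k) x fun p q => sw (k := k) p fun a b => sw (k := k) q fun c d =>
      F (hs.mul (a ⊗ₜ[k] hs.antipode c)) (hs.mul (b ⊗ₜ[k] hs.antipode d))) =
      Coalgebra.counit (R := k) x • F hs.one hs.one := by
  rw [sw_middle_comm hH x fun a b c d =>
    F (hs.mul (a ⊗ₜ[k] hs.antipode c)) (hs.mul (b ⊗ₜ[k] hs.antipode d))]
  rw [← sw_counit_left x fun y => Coalgebra.counit (R := k) y • F hs.one hs.one]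
  refine sw_congr fun p q => ?_
  rw [← hs.sw_antipode_right p fun y => Coalgebra.counit (R := k) q • F y hs.one]
  exact sw_congr fun a b => hs.sw_antipode_right q fun y => F (hs.mul (a ⊗ₜ[k] hs.antipode b)) y

/-- The antipode of a cocommutative Hopf algebra is comultiplicative. -/
theorem sw_antipode (hs : HopfStr k H) (hH : IsCocomm k H) (x : H) (F : H → H → M)
    (h₁ : ∀ q, IsLinearMap k fun p => F p q := by fun_prop)
    (h₂ : ∀ p, IsLinearMap k fun q => F p q := by fun_prop) :
    sw (k := k) (hs.antipode x) F =
      sw (k := k) x fun p q => F (hs.antipode p) (hs.antipode q) := by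
  trans sw (k := k) x fun p q => sw (k := k) q fun r s => sw (k := k) (hs.antipode p) fun u v =>
    sw (k := k) r fun a b => sw (k := k) s fun c d =>
      F (hs.mul (u ⊗ₜ[k] hs.mul (a ⊗ₜ[k] hs.antipode c)))
        (hs.mul (v ⊗ₜ[k] hs.mul (b ⊗ₜ[k] hs.antipode d)))
  · rw [← sw_counit_right x fun y => sw (k := k) (hs.antipode y) F]
    refine sw_congr fun p q => ?_
    rw [map_sw (f := fun t => Coalgebra.counit (R := k) q • t) (by fun_prop)]
    rw [sw_swap q (hs.antipode p)]
    refine sw_congr fun u v => ?_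
    refine Eq.trans ?_ (hs.sw_mul_antipode hH q fun a b =>
      F (hs.mul (u ⊗ₜ[k] a)) (hs.mul (v ⊗ₜ[k] b))).symm
    rw [hs.mul_one, hs.mul_one]
  · simp only [← hs.mul_assoc]
    rw [← sw_coassoc x fun p r s => sw (k := k) (hs.antipode p) fun u v => sw (k := k) r fun a b =>
      sw (k := k) s fun c d => F (hs.mul (hs.mul (u ⊗ₜ[k] a) ⊗ₜ[k] hs.antipode c))
        (hs.mul (hs.mul (v ⊗ₜ[k] b) ⊗ₜ[k] hs.antipode d))]
    refine Eq.trans (sw_congr fun e s => ?_) (sw_counit_left x fun s => sw (k := k) s fun c d =>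
      F (hs.antipode c) (hs.antipode d))
    simp only [← fun p r => hs.sw_mul (hs.antipode p) r fun w z => sw (k := k) s fun c d =>
      F (hs.mul (w ⊗ₜ[k] hs.antipode c)) (hs.mul (z ⊗ₜ[k] hs.antipode d))]
    rw [hs.sw_antipode_left e fun y => sw (k := k) y fun w z => sw (k := k) s fun c d =>
      F (hs.mul (w ⊗ₜ[k] hs.antipode c)) (hs.mul (z ⊗ₜ[k] hs.antipode d)),
      hs.sw_one fun w z => sw (k := k) s fun c d =>
        F (hs.mul (w ⊗ₜ[k] hs.antipode c)) (hs.mul (z ⊗ₜ[k] hs.antipode d))]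
    simp only [hs.one_mul]

end HopfStr

theorem IsCocomm.tensorProduct (hA : IsCocomm k A) (hH : IsCocomm k H) :
    IsCocomm k (A ⊗[k] H) := by
  refine TensorProduct.ext' fun a x => ?_
  rw [LinearMap.comp_apply, apply_comul, comul_eq_sw,
    sw_tmul a x fun p q => p ⊗ₜ[k] q, sw_tmul a x fun p q =>
      (TensorProduct.comm k (A ⊗[k] H) (A ⊗[k] H)).toLinearMap (p ⊗ₜ[k] q),
    sw_comm hA a fun p q => sw (k := k) x fun r s => (p ⊗ₜ[k] r) ⊗ₜ[k] (q ⊗ₜ[k] s)]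
  refine sw_congr fun p q => ?_
  rw [sw_comm hH x fun r s => (q ⊗ₜ[k] r) ⊗ₜ[k] (p ⊗ₜ[k] s)]
  rfl

/-- A Hopf algebra structure on a tensor product of coalgebras from axioms on pure tensors. -/
noncomputable def HopfStr.ofTmul (mul : (A ⊗[k] H) ⊗[k] (A ⊗[k] H) →ₗ[k] A ⊗[k] H)
    (one : A) (one' : H) (antipode : A ⊗[k] H →ₗ[k] A ⊗[k] H)
    (mul_assoc : ∀ (a b c : A) (x y z : H),
      mul (mul ((a ⊗ₜ[k] x) ⊗ₜ[k] (b ⊗ₜ[k] y)) ⊗ₜ[k] (c ⊗ₜ[k] z)) =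
        mul ((a ⊗ₜ[k] x) ⊗ₜ[k] mul ((b ⊗ₜ[k] y) ⊗ₜ[k] (c ⊗ₜ[k] z))))
    (one_mul : ∀ (a : A) (x : H), mul ((one ⊗ₜ[k] one') ⊗ₜ[k] (a ⊗ₜ[k] x)) = a ⊗ₜ[k] x)
    (mul_one : ∀ (a : A) (x : H), mul ((a ⊗ₜ[k] x) ⊗ₜ[k] (one ⊗ₜ[k] one')) = a ⊗ₜ[k] x)
    (comul_mul : ∀ (a b : A) (x y : H),
      Coalgebra.comul (R := k) (mul ((a ⊗ₜ[k] x) ⊗ₜ[k] (b ⊗ₜ[k] y))) =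
        sw (k := k) a fun a₁ a₂ => sw (k := k) x fun x₁ x₂ =>
          sw (k := k) b fun b₁ b₂ => sw (k := k) y fun y₁ y₂ =>
            mul ((a₁ ⊗ₜ[k] x₁) ⊗ₜ[k] (b₁ ⊗ₜ[k] y₁)) ⊗ₜ[k]
              mul ((a₂ ⊗ₜ[k] x₂) ⊗ₜ[k] (b₂ ⊗ₜ[k] y₂)))
    (counit_mul : ∀ (a b : A) (x y : H),
      Coalgebra.counit (R := k) (mul ((a ⊗ₜ[k] x) ⊗ₜ[k] (b ⊗ₜ[k] y))) =
        Coalgebra.counit (R := k) (a ⊗ₜ[k] x) • Coalgebra.counit (R := k) (b ⊗ₜ[k] y))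
    (comul_one : Coalgebra.comul (R := k) one = one ⊗ₜ[k] one)
    (comul_one' : Coalgebra.comul (R := k) one' = one' ⊗ₜ[k] one')
    (counit_one : Coalgebra.counit (R := k) one = 1)
    (counit_one' : Coalgebra.counit (R := k) one' = 1)
    (antipode_left : ∀ (a : A) (x : H),
      (sw (k := k) a fun a₁ a₂ => sw (k := k) x fun x₁ x₂ =>
        mul (antipode (a₁ ⊗ₜ[k] x₁) ⊗ₜ[k] (a₂ ⊗ₜ[k] x₂))) =
      Coalgebra.counit (R := k) a • Coalgebra.counit (R := k) x • (one ⊗ₜ[k] one'))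
    (antipode_right : ∀ (a : A) (x : H),
      (sw (k := k) a fun a₁ a₂ => sw (k := k) x fun x₁ x₂ =>
        mul ((a₁ ⊗ₜ[k] x₁) ⊗ₜ[k] antipode (a₂ ⊗ₜ[k] x₂))) =
      Coalgebra.counit (R := k) a • Coalgebra.counit (R := k) x • (one ⊗ₜ[k] one')) :
    HopfStr k (A ⊗[k] H) where
  mul := mul
  one := one ⊗ₜ[k] one'
  antipode := antipode
  mul_assoc u v w := by
    refine eq_of_forall_tmul (f := fun u => mul (mul (u ⊗ₜ[k] v) ⊗ₜ[k] w))
      (g := fun u => mul (u ⊗ₜ[k] mul (v ⊗ₜ[k] w))) (by fun_prop) (by fun_prop)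
      (fun a x => ?_) u
    refine eq_of_forall_tmul (f := fun v => mul (mul ((a ⊗ₜ[k] x) ⊗ₜ[k] v) ⊗ₜ[k] w))
      (g := fun v => mul ((a ⊗ₜ[k] x) ⊗ₜ[k] mul (v ⊗ₜ[k] w))) (by fun_prop) (by fun_prop)
      (fun b y => ?_) v
    exact eq_of_forall_tmul
      (f := fun w => mul (mul ((a ⊗ₜ[k] x) ⊗ₜ[k] (b ⊗ₜ[k] y)) ⊗ₜ[k] w))
      (g := fun w => mul ((a ⊗ₜ[k] x) ⊗ₜ[k] mul ((b ⊗ₜ[k] y) ⊗ₜ[k] w)))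
      (by fun_prop) (by fun_prop) (fun c z => mul_assoc a b c x y z) w
  one_mul u := eq_of_forall_tmul (f := fun u => mul ((one ⊗ₜ[k] one') ⊗ₜ[k] u))
    (g := fun u => u) (by fun_prop) (by fun_prop) one_mul u
  mul_one u := eq_of_forall_tmul (f := fun u => mul (u ⊗ₜ[k] (one ⊗ₜ[k] one')))
    (g := fun u => u) (by fun_prop) (by fun_prop) mul_one u
  comul_mul u v := by
    rw [apply_tensorTensorTensorComm_comul (TensorProduct.map mul mul)]
    simp only [TensorProduct.map_tmul]
    refine eq_of_forall_tmul (f := fun u => Coalgebra.comul (R := k) (mul (u ⊗ₜ[k] v)))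
      (g := fun u => sw (k := k) u fun p q => sw (k := k) v fun r s =>
        mul (p ⊗ₜ[k] r) ⊗ₜ[k] mul (q ⊗ₜ[k] s)) (by fun_prop) (by fun_prop)
      (fun a x => ?_) u
    refine eq_of_forall_tmul
      (f := fun v => Coalgebra.comul (R := k) (mul ((a ⊗ₜ[k] x) ⊗ₜ[k] v)))
      (g := fun v => sw (k := k) (a ⊗ₜ[k] x) fun p q => sw (k := k) v fun r s =>
        mul (p ⊗ₜ[k] r) ⊗ₜ[k] mul (q ⊗ₜ[k] s)) (by fun_prop) (by fun_prop)
      (fun b y => ?_) v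
    rw [comul_mul, sw_tmul a x fun p q => sw (k := k) (b ⊗ₜ[k] y) fun r s =>
      mul (p ⊗ₜ[k] r) ⊗ₜ[k] mul (q ⊗ₜ[k] s)]
    refine sw_congr fun a₁ a₂ => sw_congr fun x₁ x₂ => ?_
    rw [sw_tmul b y fun r s => mul ((a₁ ⊗ₜ[k] x₁) ⊗ₜ[k] r) ⊗ₜ[k] mul ((a₂ ⊗ₜ[k] x₂) ⊗ₜ[k] s)]
  counit_mul u v := by
    simp only [← smul_eq_mul]
    refine eq_of_forall_tmul (f := fun u => Coalgebra.counit (R := k) (mul (u ⊗ₜ[k] v)))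
      (g := fun u => Coalgebra.counit (R := k) u • Coalgebra.counit (R := k) v)
      (by fun_prop) (by fun_prop) (fun a x => ?_) u
    exact eq_of_forall_tmul
      (f := fun v => Coalgebra.counit (R := k) (mul ((a ⊗ₜ[k] x) ⊗ₜ[k] v)))
      (g := fun v => Coalgebra.counit (R := k) (a ⊗ₜ[k] x) • Coalgebra.counit (R := k) v)
      (by fun_prop) (by fun_prop) (fun b y => counit_mul a b x y) v
  comul_one := by
    rw [TensorProduct.comul_tmul, comul_one, comul_one']
    rfl
  counit_one := by
    rw [TensorProduct.counit_tmul, counit_one, counit_one', one_smul]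
  antipode_left := by
    refine TensorProduct.ext' fun a x => ?_
    rw [← LinearMap.comp_assoc, LinearMap.comp_apply, apply_comul]
    simp only [LinearMap.comp_apply, rTensor_tmul, toSpanSingleton_apply,
      TensorProduct.counit_tmul]
    rw [sw_tmul _ _ fun p q => mul (antipode p ⊗ₜ[k] q), antipode_left, smul_smul, mul_comm,
      smul_eq_mul]
  antipode_right := by
    refine TensorProduct.ext' fun a x => ?_
    rw [← LinearMap.comp_assoc, LinearMap.comp_apply, apply_comul]
    simp only [LinearMap.comp_apply, lTensor_tmul, toSpanSingleton_apply,
      TensorProduct.counit_tmul]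
    rw [sw_tmul _ _ fun p q => mul (p ⊗ₜ[k] antipode q), antipode_right, smul_smul, mul_comm,
      smul_eq_mul]

theorem linearMap_sw (f : M →ₗ[k] N) (x : H) (F : H → H → M) :
    f (sw (k := k) x F) = sw (k := k) x fun p q => f (F p q) :=
  map_sw f.isLinear x F

theorem sw_tmul_elem (x : H) (F : H → H → M) (n : N) :
    sw (k := k) x F ⊗ₜ[k] n = sw (k := k) x fun p q => F p q ⊗ₜ[k] n :=
  map_sw (f := fun t => t ⊗ₜ[k] n) (by fun_prop) x F

theorem tmul_sw (n : N) (x : H) (F : H → H → M) :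
    n ⊗ₜ[k] sw (k := k) x F = sw (k := k) x fun p q => n ⊗ₜ[k] F p q :=
  map_sw (f := fun t => n ⊗ₜ[k] t) (by fun_prop) x F

/-- The tensor product of two Hopf structures. -/
noncomputable def HopfStr.tensorProduct (hA : HopfStr k A) (hH : HopfStr k H) :
    HopfStr k (A ⊗[k] H) :=
  HopfStr.ofTmul
    (TensorProduct.map hA.mul hH.mul ∘ₗ
      (TensorProduct.tensorTensorTensorComm k A H A H).toLinearMap)
    hA.one hH.one (TensorProduct.map hA.antipode hH.antipode)
    (fun a b c x y z => congrArg₂ (· ⊗ₜ[k] ·) (hA.mul_assoc a b c) (hH.mul_assoc x y z))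
    (fun a x => congrArg₂ (· ⊗ₜ[k] ·) (hA.one_mul a) (hH.one_mul x))
    (fun a x => congrArg₂ (· ⊗ₜ[k] ·) (hA.mul_one a) (hH.mul_one x))
    (fun a b x y => by
      change Coalgebra.comul (hA.mul (a ⊗ₜ[k] b) ⊗ₜ[k] hH.mul (x ⊗ₜ[k] y)) = _
      rw [comul_eq_sw, sw_tmul (C := A) (D := H) _ _ fun p q => p ⊗ₜ[k] q,
        hA.sw_mul a b fun p q => sw (k := k) (hH.mul (x ⊗ₜ[k] y)) fun r s =>
          (p ⊗ₜ[k] r) ⊗ₜ[k] (q ⊗ₜ[k] s)]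
      refine sw_congr fun a₁ a₂ => ?_
      rw [sw_swap x b]
      refine sw_congr fun b₁ b₂ => hH.sw_mul x y fun r s =>
        (hA.mul (a₁ ⊗ₜ[k] b₁) ⊗ₜ[k] r) ⊗ₜ[k] (hA.mul (a₂ ⊗ₜ[k] b₂) ⊗ₜ[k] s))
    (fun a b x y => by
      change Coalgebra.counit (hA.mul (a ⊗ₜ[k] b) ⊗ₜ[k] hH.mul (x ⊗ₜ[k] y)) = _
      simp only [TensorProduct.counit_tmul, hA.counit_mul, hH.counit_mul, smul_eq_mul]
      ring)
    hA.comul_one hH.comul_one hA.counit_one hH.counit_one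
    (fun a x => by
      change (sw (k := k) a fun a₁ a₂ => sw (k := k) x fun x₁ x₂ =>
        hA.mul (hA.antipode a₁ ⊗ₜ[k] a₂) ⊗ₜ[k] hH.mul (hH.antipode x₁ ⊗ₜ[k] x₂)) = _
      rw [hA.sw_antipode_left a fun t => sw (k := k) x fun x₁ x₂ =>
          t ⊗ₜ[k] hH.mul (hH.antipode x₁ ⊗ₜ[k] x₂),
        hH.sw_antipode_left x fun t => hA.one ⊗ₜ[k] t])
    (fun a x => by
      change (sw (k := k) a fun a₁ a₂ => sw (k := k) x fun x₁ x₂ =>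
        hA.mul (a₁ ⊗ₜ[k] hA.antipode a₂) ⊗ₜ[k] hH.mul (x₁ ⊗ₜ[k] hH.antipode x₂)) = _
      rw [hA.sw_antipode_right a fun t => sw (k := k) x fun x₁ x₂ =>
          t ⊗ₜ[k] hH.mul (x₁ ⊗ₜ[k] hH.antipode x₂),
        hH.sw_antipode_right x fun t => hA.one ⊗ₜ[k] t])

theorem IsModuleAlgebraLaw.sw_act_mul {hA : HopfStr k A} {act : H ⊗[k] A →ₗ[k] A}
    (h : IsModuleAlgebraLaw hA act) (x : H) (a b : A) :
    act (x ⊗ₜ[k] hA.mul (a ⊗ₜ[k] b)) = sw (k := k) x fun p q =>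
      hA.mul (act (p ⊗ₜ[k] a) ⊗ₜ[k] act (q ⊗ₜ[k] b)) := by
  rw [h.act_mul, comul_eq_sw, sw_tmul_elem]
  simp only [← LinearEquiv.coe_coe, linearMap_sw]
  rfl

theorem IsCoalgebraLaw.sw_act {act : H ⊗[k] A →ₗ[k] A} (h : IsCoalgebraLaw act)
    (x : H) (a : A) (F : A → A → M)
    (h₁ : ∀ q, IsLinearMap k fun p => F p q := by fun_prop)
    (h₂ : ∀ p, IsLinearMap k fun q => F p q := by fun_prop) :
    sw (k := k) (act (x ⊗ₜ[k] a)) F = sw (k := k) x fun p q => sw (k := k) a fun r s =>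
      F (act (p ⊗ₜ[k] r)) (act (q ⊗ₜ[k] s)) := by
  rw [sw_eq_bilift _ F h₁ h₂, h.comul_act, split, ← LinearMap.comp_apply,
    apply_tensorTensorTensorComm_comul]
  rfl

/-- The multiplication `(a ⊗ x) ∘ (b ⊗ y) = a(x₍₁₎ ▶ b) ⊗ yx₍₂₎` on `A ⊗ H`. -/
noncomputable def opSmashMul (hA : HopfStr k A) (hH : HopfStr k H) (act : H ⊗[k] A →ₗ[k] A) :
    (A ⊗[k] H) ⊗[k] (A ⊗[k] H) →ₗ[k] A ⊗[k] H :=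
  sandwich k hA.mul (hH.mul ∘ₗ (TensorProduct.comm k H H).toLinearMap)
    ∘ₗ (TensorProduct.assoc k A (A ⊗[k] H) H).symm.toLinearMap
    ∘ₗ lTensor A (rTensor H (rTensor H act ∘ₗ rightComm k H H A ∘ₗ rTensor A Coalgebra.comul)
      ∘ₗ (TensorProduct.assoc k H A H).symm.toLinearMap)
    ∘ₗ (TensorProduct.assoc k A H (A ⊗[k] H)).toLinearMap

theorem opSmashMul_tmul_eq_sandwich (hA : HopfStr k A) (hH : HopfStr k H)
    (act : H ⊗[k] A →ₗ[k] A) (a b : A) (x y : H) :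
    opSmashMul hA hH act ((a ⊗ₜ[k] x) ⊗ₜ[k] (b ⊗ₜ[k] y)) =
      sandwich k hA.mul (hH.mul ∘ₗ (TensorProduct.comm k H H).toLinearMap)
        ((a ⊗ₜ[k] smashEl act x b) ⊗ₜ[k] y) :=
  rfl

theorem opSmashMul_tmul (hA : HopfStr k A) (hH : HopfStr k H)
    (act : H ⊗[k] A →ₗ[k] A) (a b : A) (x y : H) :
    opSmashMul hA hH act ((a ⊗ₜ[k] x) ⊗ₜ[k] (b ⊗ₜ[k] y)) = sw (k := k) x fun p q =>
      hA.mul (a ⊗ₜ[k] act (p ⊗ₜ[k] b)) ⊗ₜ[k] hH.mul (y ⊗ₜ[k] q) := by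
  rw [opSmashMul_tmul_eq_sandwich, smashEl, comul_eq_sw]
  simp only [sw_tmul_elem, linearMap_sw, tmul_sw]
  rfl

/-- The antipode `a ⊗ x ↦ (S(x₍₁₎) ▶ S(a)) ⊗ S(x₍₂₎)` for the multiplication `opSmashMul`. -/
noncomputable def opSmashAntipode (hA : HopfStr k A) (hH : HopfStr k H)
    (act : H ⊗[k] A →ₗ[k] A) : A ⊗[k] H →ₗ[k] A ⊗[k] H :=
  bilift (fun a x => sw (k := k) x fun p q =>
      act (hH.antipode p ⊗ₜ[k] hA.antipode a) ⊗ₜ[k] hH.antipode q)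
    (by fun_prop) (by fun_prop)

theorem opSmashAntipode_tmul (hA : HopfStr k A) (hH : HopfStr k H)
    (act : H ⊗[k] A →ₗ[k] A) (a : A) (x : H) :
    opSmashAntipode hA hH act (a ⊗ₜ[k] x) = sw (k := k) x fun p q =>
      act (hH.antipode p ⊗ₜ[k] hA.antipode a) ⊗ₜ[k] hH.antipode q :=
  rfl

section OpSmash

variable {hA : HopfStr k A} {hH : HopfStr k H} {act : H ⊗[k] A →ₗ[k] A}

theorem opSmashMul_assoc (hop : IsLeftOpModuleBialgebra hH hA act) (a b c : A) (x y z : H) :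
    opSmashMul hA hH act
        (opSmashMul hA hH act ((a ⊗ₜ[k] x) ⊗ₜ[k] (b ⊗ₜ[k] y)) ⊗ₜ[k] (c ⊗ₜ[k] z)) =
      opSmashMul hA hH act
        ((a ⊗ₜ[k] x) ⊗ₜ[k] opSmashMul hA hH act ((b ⊗ₜ[k] y) ⊗ₜ[k] (c ⊗ₜ[k] z))) := by
  simp only [opSmashMul_tmul, sw_tmul_elem, tmul_sw, linearMap_sw, hop.toLaw.sw_act_mul]
  rw [sw_swap y x]
  simp only [fun y q p => hH.sw_mul y q fun u v =>
    hA.mul (hA.mul (a ⊗ₜ[k] act (p ⊗ₜ[k] b)) ⊗ₜ[k] act (u ⊗ₜ[k] c)) ⊗ₜ[k]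
      hH.mul (z ⊗ₜ[k] v)]
  simp only [sw_swap y, hop.toIsLeftOpModule.mul_act, hA.mul_assoc, ← hH.mul_assoc]
  rw [sw_coassoc x fun p t w => sw (k := k) y fun r s =>
    hA.mul (a ⊗ₜ[k] hA.mul (act (p ⊗ₜ[k] b) ⊗ₜ[k] act (t ⊗ₜ[k] act (r ⊗ₜ[k] c)))) ⊗ₜ[k]
      hH.mul (hH.mul (z ⊗ₜ[k] s) ⊗ₜ[k] w)]

theorem opSmashMul_one_left (hop : IsLeftOpModuleBialgebra hH hA act) (a : A) (x : H) :
    opSmashMul hA hH act ((hA.one ⊗ₜ[k] hH.one) ⊗ₜ[k] (a ⊗ₜ[k] x)) = a ⊗ₜ[k] x := by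
  rw [opSmashMul_tmul, hH.sw_one fun p q =>
      hA.mul (hA.one ⊗ₜ[k] act (p ⊗ₜ[k] a)) ⊗ₜ[k] hH.mul (x ⊗ₜ[k] q),
    hop.toIsLeftOpModule.one_act, hA.one_mul, hH.mul_one]

theorem opSmashMul_one_right (hop : IsLeftOpModuleBialgebra hH hA act) (a : A) (x : H) :
    opSmashMul hA hH act ((a ⊗ₜ[k] x) ⊗ₜ[k] (hA.one ⊗ₜ[k] hH.one)) = a ⊗ₜ[k] x := by
  simp only [opSmashMul_tmul, hop.toLaw.act_one, tmul_smul, map_smul, ← smul_tmul', hA.mul_one,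
    hH.one_mul]
  exact sw_counit_left x fun q => a ⊗ₜ[k] q

theorem comul_opSmashMul (hH' : IsCocomm k H) (hop : IsLeftOpModuleBialgebra hH hA act)
    (a b : A) (x y : H) :
    Coalgebra.comul (R := k) (opSmashMul hA hH act ((a ⊗ₜ[k] x) ⊗ₜ[k] (b ⊗ₜ[k] y))) =
      sw (k := k) a fun a₁ a₂ => sw (k := k) x fun x₁ x₂ =>
        sw (k := k) b fun b₁ b₂ => sw (k := k) y fun y₁ y₂ =>
          opSmashMul hA hH act ((a₁ ⊗ₜ[k] x₁) ⊗ₜ[k] (b₁ ⊗ₜ[k] y₁)) ⊗ₜ[k]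
            opSmashMul hA hH act ((a₂ ⊗ₜ[k] x₂) ⊗ₜ[k] (b₂ ⊗ₜ[k] y₂)) := by
  trans sw (k := k) a fun a₁ a₂ => sw (k := k) x fun x₁ x₂ => sw (k := k) x₁ fun t u =>
    sw (k := k) x₂ fun v w => sw (k := k) b fun b₁ b₂ => sw (k := k) y fun y₁ y₂ =>
      (hA.mul (a₁ ⊗ₜ[k] act (t ⊗ₜ[k] b₁)) ⊗ₜ[k] hH.mul (y₁ ⊗ₜ[k] v)) ⊗ₜ[k]
        (hA.mul (a₂ ⊗ₜ[k] act (u ⊗ₜ[k] b₂)) ⊗ₜ[k] hH.mul (y₂ ⊗ₜ[k] w))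
  · rw [opSmashMul_tmul, linearMap_sw, sw_swap a x]
    refine sw_congr fun p q => ?_
    rw [comul_eq_sw, sw_tmul (C := A) (D := H) _ _ fun p q => p ⊗ₜ[k] q,
      hA.sw_mul a (act (p ⊗ₜ[k] b)) fun e f => sw (k := k) (hH.mul (y ⊗ₜ[k] q)) fun r s =>
        (e ⊗ₜ[k] r) ⊗ₜ[k] (f ⊗ₜ[k] s)]
    refine sw_congr fun a₁ a₂ => ?_
    rw [hop.toCoalgLaw.sw_act p b fun e f => sw (k := k) (hH.mul (y ⊗ₜ[k] q)) fun r s =>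
        (hA.mul (a₁ ⊗ₜ[k] e) ⊗ₜ[k] r) ⊗ₜ[k] (hA.mul (a₂ ⊗ₜ[k] f) ⊗ₜ[k] s)]
    refine sw_congr fun t u => ?_
    rw [sw_swap q b]
    refine sw_congr fun b₁ b₂ => ?_
    rw [sw_swap q y]
    exact hH.sw_mul y q fun r s => (hA.mul (a₁ ⊗ₜ[k] act (t ⊗ₜ[k] b₁)) ⊗ₜ[k] r) ⊗ₜ[k]
      (hA.mul (a₂ ⊗ₜ[k] act (u ⊗ₜ[k] b₂)) ⊗ₜ[k] s)
  · refine sw_congr fun a₁ a₂ => ?_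
    rw [sw_middle_comm hH' x fun t u v w => sw (k := k) b fun b₁ b₂ => sw (k := k) y fun y₁ y₂ =>
      (hA.mul (a₁ ⊗ₜ[k] act (t ⊗ₜ[k] b₁)) ⊗ₜ[k] hH.mul (y₁ ⊗ₜ[k] v)) ⊗ₜ[k]
        (hA.mul (a₂ ⊗ₜ[k] act (u ⊗ₜ[k] b₂)) ⊗ₜ[k] hH.mul (y₂ ⊗ₜ[k] w))]
    refine sw_congr fun x₁ x₂ => ?_
    simp only [opSmashMul_tmul, sw_tmul_elem, tmul_sw]
    simp only [sw_swap x₂ b, sw_swap x₁ b, sw_swap x₂ y, sw_swap x₁ y, sw_swap x₂ x₁]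

theorem counit_opSmashMul (hop : IsLeftOpModuleBialgebra hH hA act) (a b : A) (x y : H) :
    Coalgebra.counit (R := k) (opSmashMul hA hH act ((a ⊗ₜ[k] x) ⊗ₜ[k] (b ⊗ₜ[k] y))) =
      Coalgebra.counit (R := k) (a ⊗ₜ[k] x) • Coalgebra.counit (R := k) (b ⊗ₜ[k] y) := by
  simp only [opSmashMul_tmul, linearMap_sw, TensorProduct.counit_tmul, hA.counit_mul,
    hH.counit_mul, hop.toCoalgLaw.counit_act, smul_eq_mul]
  refine Eq.trans (sw_congr fun p q => ?_) (Eq.trans (sw_counit_left x fun q =>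
    (Coalgebra.counit (R := k) a * (Coalgebra.counit (R := k) y * Coalgebra.counit (R := k) b)) •
      Coalgebra.counit (R := k) q) ?_)
  all_goals
    simp only [smul_eq_mul]
    ring

theorem opSmashMul_antipode_right (hH' : IsCocomm k H)
    (hop : IsLeftOpModuleBialgebra hH hA act) (a : A) (x : H) :
    (sw (k := k) a fun a₁ a₂ => sw (k := k) x fun x₁ x₂ =>
      opSmashMul hA hH act ((a₁ ⊗ₜ[k] x₁) ⊗ₜ[k] opSmashAntipode hA hH act (a₂ ⊗ₜ[k] x₂))) =
      Coalgebra.counit (R := k) a • Coalgebra.counit (R := k) x • (hA.one ⊗ₜ[k] hH.one) := by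
  rw [← hA.sw_antipode_right a fun t => Coalgebra.counit (R := k) x • (t ⊗ₜ[k] hH.one)]
  refine sw_congr fun a₁ a₂ => ?_
  simp only [opSmashAntipode_tmul, tmul_sw, linearMap_sw, opSmashMul_tmul,
    ← hop.toIsLeftOpModule.mul_act]
  rw [sw_comm hH' x fun x₁ x₂ => sw (k := k) x₂ fun p q => sw (k := k) x₁ fun r s =>
      hA.mul (a₁ ⊗ₜ[k] act (hH.mul (hH.antipode p ⊗ₜ[k] r) ⊗ₜ[k] hA.antipode a₂)) ⊗ₜ[k]
        hH.mul (hH.antipode q ⊗ₜ[k] s),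
    sw_middle_comm hH' x fun p q r s =>
      hA.mul (a₁ ⊗ₜ[k] act (hH.mul (hH.antipode p ⊗ₜ[k] r) ⊗ₜ[k] hA.antipode a₂)) ⊗ₜ[k]
        hH.mul (hH.antipode q ⊗ₜ[k] s)]
  rw [← sw_counit_left x fun y => Coalgebra.counit (R := k) y •
    (hA.mul (a₁ ⊗ₜ[k] hA.antipode a₂) ⊗ₜ[k] hH.one)]
  refine sw_congr fun u v => ?_
  rw [hH.sw_antipode_left u fun t => sw (k := k) v fun q s =>
      hA.mul (a₁ ⊗ₜ[k] act (t ⊗ₜ[k] hA.antipode a₂)) ⊗ₜ[k] hH.mul (hH.antipode q ⊗ₜ[k] s),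
    hH.sw_antipode_left v fun t =>
      hA.mul (a₁ ⊗ₜ[k] act (hH.one ⊗ₜ[k] hA.antipode a₂)) ⊗ₜ[k] t,
    hop.toIsLeftOpModule.one_act]

theorem opSmashMul_antipode_left (hH' : IsCocomm k H)
    (hop : IsLeftOpModuleBialgebra hH hA act) (a : A) (x : H) :
    (sw (k := k) a fun a₁ a₂ => sw (k := k) x fun x₁ x₂ =>
      opSmashMul hA hH act (opSmashAntipode hA hH act (a₁ ⊗ₜ[k] x₁) ⊗ₜ[k] (a₂ ⊗ₜ[k] x₂))) =
      Coalgebra.counit (R := k) a • Coalgebra.counit (R := k) x • (hA.one ⊗ₜ[k] hH.one) := by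
  trans sw (k := k) a fun a₁ a₂ =>
    act (hH.antipode x ⊗ₜ[k] hA.mul (hA.antipode a₁ ⊗ₜ[k] a₂)) ⊗ₜ[k] hH.one
  · refine sw_congr fun a₁ a₂ => ?_
    simp only [opSmashAntipode_tmul, sw_tmul_elem, linearMap_sw, opSmashMul_tmul]
    simp only [fun p q x₂ => hH.sw_antipode hH' q fun r s =>
      hA.mul (act (hH.antipode p ⊗ₜ[k] hA.antipode a₁) ⊗ₜ[k] act (r ⊗ₜ[k] a₂)) ⊗ₜ[k]
        hH.mul (x₂ ⊗ₜ[k] s)]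
    simp only [fun x₁ x₂ => (sw_coassoc x₁ fun p r s =>
      hA.mul (act (hH.antipode p ⊗ₜ[k] hA.antipode a₁) ⊗ₜ[k] act (hH.antipode r ⊗ₜ[k] a₂)) ⊗ₜ[k]
        hH.mul (x₂ ⊗ₜ[k] hH.antipode s)).symm]
    rw [sw_coassoc x fun e s x₂ => sw (k := k) e fun p r =>
      hA.mul (act (hH.antipode p ⊗ₜ[k] hA.antipode a₁) ⊗ₜ[k] act (hH.antipode r ⊗ₜ[k] a₂)) ⊗ₜ[k]
        hH.mul (x₂ ⊗ₜ[k] hH.antipode s)]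
    rw [hop.toLaw.sw_act_mul, hH.sw_antipode hH' x fun p q =>
        hA.mul (act (p ⊗ₜ[k] hA.antipode a₁) ⊗ₜ[k] act (q ⊗ₜ[k] a₂)), sw_tmul_elem,
      ← sw_counit_right x fun e => sw (k := k) e fun p r =>
      hA.mul (act (hH.antipode p ⊗ₜ[k] hA.antipode a₁) ⊗ₜ[k] act (hH.antipode r ⊗ₜ[k] a₂)) ⊗ₜ[k]
        hH.one]
    refine sw_congr fun e t => ?_
    rw [sw_comm hH' t fun s x₂ => sw (k := k) e fun p r =>
      hA.mul (act (hH.antipode p ⊗ₜ[k] hA.antipode a₁) ⊗ₜ[k] act (hH.antipode r ⊗ₜ[k] a₂)) ⊗ₜ[k]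
        hH.mul (x₂ ⊗ₜ[k] hH.antipode s)]
    exact hH.sw_antipode_right t fun w => sw (k := k) e fun p r =>
      hA.mul (act (hH.antipode p ⊗ₜ[k] hA.antipode a₁) ⊗ₜ[k] act (hH.antipode r ⊗ₜ[k] a₂)) ⊗ₜ[k] w
  · rw [hA.sw_antipode_left a fun t => act (hH.antipode x ⊗ₜ[k] t) ⊗ₜ[k] hH.one,
      hop.toLaw.act_one, hH.counit_antipode, ← smul_tmul']

/-- The Hopf structure on `A ⊗ H` with multiplication `opSmashMul`. -/
noncomputable def HopfStr.opSmash (hH' : IsCocomm k H)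
    (hop : IsLeftOpModuleBialgebra hH hA act) : HopfStr k (A ⊗[k] H) :=
  HopfStr.ofTmul (opSmashMul hA hH act) hA.one hH.one (opSmashAntipode hA hH act)
    (opSmashMul_assoc hop) (opSmashMul_one_left hop) (opSmashMul_one_right hop)
    (comul_opSmashMul hH' hop) (counit_opSmashMul hop)
    hA.comul_one hH.comul_one hA.counit_one hH.counit_one
    (opSmashMul_antipode_left hH' hop) (opSmashMul_antipode_right hH' hop)

end OpSmash

theorem braceRHS_tmul_s9 (m : H ⊗[k] H →ₗ[k] H) (S : H →ₗ[k] H) (m' : H ⊗[k] H →ₗ[k] H)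
    (x y z : H) :
    braceRHS m S m' (x ⊗ₜ[k] (y ⊗ₜ[k] z)) = sw (k := k) x fun p q => sw (k := k) q fun r s =>
      m (m' (p ⊗ₜ[k] y) ⊗ₜ[k] m (S r ⊗ₜ[k] m' (s ⊗ₜ[k] z))) := by
  simp only [braceRHS, LinearMap.comp_apply, rTensor_tmul, comul_eq_sw, linearMap_sw,
    lTensor_tmul, tmul_sw, sw_tmul_elem]
  rfl

theorem opSmash_brace {hA : HopfStr k A} {hH : HopfStr k H} {act : H ⊗[k] A →ₗ[k] A}
    (hop : IsLeftOpModuleBialgebra hH hA act) :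
    opSmashMul hA hH act ∘ₗ lTensor (A ⊗[k] H) (hA.tensorProduct hH).mul =
      braceRHS (hA.tensorProduct hH).mul (hA.tensorProduct hH).antipode
        (opSmashMul hA hH act) := by
  have mul_tmul (a b : A) (x y : H) : (hA.tensorProduct hH).mul
      ((a ⊗ₜ[k] x) ⊗ₜ[k] (b ⊗ₜ[k] y)) = hA.mul (a ⊗ₜ[k] b) ⊗ₜ[k] hH.mul (x ⊗ₜ[k] y) := rfl
  have antipode_tmul (a : A) (x : H) : (hA.tensorProduct hH).antipode (a ⊗ₜ[k] x) =
      hA.antipode a ⊗ₜ[k] hH.antipode x := rfl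
  ext a x b y c z
  change opSmashMul hA hH act ((a ⊗ₜ[k] x) ⊗ₜ[k]
    (hA.tensorProduct hH).mul ((b ⊗ₜ[k] y) ⊗ₜ[k] (c ⊗ₜ[k] z))) =
      braceRHS (hA.tensorProduct hH).mul (hA.tensorProduct hH).antipode
        (opSmashMul hA hH act) ((a ⊗ₜ[k] x) ⊗ₜ[k] ((b ⊗ₜ[k] y) ⊗ₜ[k] (c ⊗ₜ[k] z)))
  rw [braceRHS_tmul_s9, sw_tmul a x fun p q => sw (k := k) q fun r s =>
    (hA.tensorProduct hH).mul (opSmashMul hA hH act (p ⊗ₜ[k] (b ⊗ₜ[k] y)) ⊗ₜ[k]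
      (hA.tensorProduct hH).mul ((hA.tensorProduct hH).antipode r ⊗ₜ[k]
        opSmashMul hA hH act (s ⊗ₜ[k] (c ⊗ₜ[k] z))))]
  simp only [fun a₁ x₁ a' x' => sw_tmul a' x' fun r s =>
    (hA.tensorProduct hH).mul (opSmashMul hA hH act ((a₁ ⊗ₜ[k] x₁) ⊗ₜ[k] (b ⊗ₜ[k] y)) ⊗ₜ[k]
      (hA.tensorProduct hH).mul ((hA.tensorProduct hH).antipode r ⊗ₜ[k]
        opSmashMul hA hH act (s ⊗ₜ[k] (c ⊗ₜ[k] z))))]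
  simp only [opSmashMul_tmul, mul_tmul, antipode_tmul, sw_tmul_elem, tmul_sw, linearMap_sw]
  let K (a₁ w : A) (e : H) (g : H) (p q : H) : A ⊗[k] H :=
    hA.mul (hA.mul (a₁ ⊗ₜ[k] act (e ⊗ₜ[k] b)) ⊗ₜ[k] hA.mul (w ⊗ₜ[k] act (p ⊗ₜ[k] c))) ⊗ₜ[k]
      hH.mul (y ⊗ₜ[k] hH.mul (g ⊗ₜ[k] hH.mul (z ⊗ₜ[k] q)))
  symm
  trans sw (k := k) x fun e t => sw (k := k) t fun p q => K a hA.one e hH.one p q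
  · rw [← sw_counit_right a fun a₁ => sw (k := k) x fun e t => sw (k := k) t fun p q =>
      K a₁ hA.one e hH.one p q]
    refine sw_congr fun a₁ a' => ?_
    rw [← hA.sw_antipode_left a' fun w => sw (k := k) x fun e t => sw (k := k) t fun p q =>
      K a₁ w e hH.one p q, sw_swap x a']
    refine sw_congr fun a₂ a₃ => ?_
    trans sw (k := k) x fun r s => sw (k := k) r fun e f => sw (k := k) s fun u v =>
      sw (k := k) v fun p q =>
        K a₁ (hA.mul (hA.antipode a₂ ⊗ₜ[k] a₃)) e (hH.mul (f ⊗ₜ[k] hH.antipode u)) p q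
    · refine sw_congr fun r s => ?_
      rw [sw_swap r s]
      refine sw_congr fun u v => ?_
      rw [sw_swap r v]
      simp only [K, hA.mul_assoc, hH.mul_assoc]
    · rw [sw_coassoc x fun e f s => sw (k := k) s fun u v => sw (k := k) v fun p q =>
        K a₁ (hA.mul (hA.antipode a₂ ⊗ₜ[k] a₃)) e (hH.mul (f ⊗ₜ[k] hH.antipode u)) p q]
      refine sw_congr fun e t => ?_
      rw [← sw_coassoc t fun f u v => sw (k := k) v fun p q =>
          K a₁ (hA.mul (hA.antipode a₂ ⊗ₜ[k] a₃)) e (hH.mul (f ⊗ₜ[k] hH.antipode u)) p q,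
        ← sw_counit_left t fun v => sw (k := k) v fun p q =>
          K a₁ (hA.mul (hA.antipode a₂ ⊗ₜ[k] a₃)) e hH.one p q]
      exact sw_congr fun f v => hH.sw_antipode_right f fun g => sw (k := k) v fun p q =>
        K a₁ (hA.mul (hA.antipode a₂ ⊗ₜ[k] a₃)) e g p q
  · simp only [K, hop.toLaw.sw_act_mul, tmul_sw, sw_tmul_elem, linearMap_sw, hA.mul_one,
      hH.mul_one, ← hA.mul_assoc, ← hH.mul_assoc]
    rw [sw_coassoc x fun e p q => hA.mul (hA.mul (a ⊗ₜ[k] act (e ⊗ₜ[k] b)) ⊗ₜ[k]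
      act (p ⊗ₜ[k] c)) ⊗ₜ[k] hH.mul (hH.mul (y ⊗ₜ[k] z) ⊗ₜ[k] q)]

end Hopf

/-- (Example `gen 2)`). Let `A`, `H` be Hopf algebras with `H` cocommutative and
`(A, ▶)` a left `H^op`-module bialgebra. Then the tensor product coalgebra `A ⊗ H` with
`(a ⊗ x)(b ⊗ y) = ab ⊗ xy` and `(a ⊗ x) ∘ (b ⊗ y) = a(x₍₁₎ ▶ b) ⊗ yx₍₂₎` is a Hopf brace;
it is cocommutative if `A` is cocommutative. -/
theorem statement9 {k : Type u} [Field k]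
    {A H : Type u} [AddCommGroup A] [Module k A] [Coalgebra k A]
    [AddCommGroup H] [Module k H] [Coalgebra k H]
    (hA : HopfStr k A) (hH : HopfStr k H) (hHcocomm : IsCocomm k H)
    (bact : H ⊗[k] A →ₗ[k] A)
    (hop : IsLeftOpModuleBialgebra hH hA bact) :
    ∃ B : HopfBrace k (A ⊗[k] H),
      (∀ (a b : A) (x y : H),
        B.dot.mul ((a ⊗ₜ[k] x) ⊗ₜ[k] (b ⊗ₜ[k] y)) =
          hA.mul (a ⊗ₜ[k] b) ⊗ₜ[k] hH.mul (x ⊗ₜ[k] y)) ∧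
      (∀ (a b : A) (x y : H),
        B.circ.mul ((a ⊗ₜ[k] x) ⊗ₜ[k] (b ⊗ₜ[k] y)) =
          sandwich k hA.mul (hH.mul ∘ₗ (TensorProduct.comm k H H).toLinearMap)
            ((a ⊗ₜ[k] smashEl bact x b) ⊗ₜ[k] y)) ∧
      (IsCocomm k A → IsCocomm k (A ⊗[k] H)) := by
  exact ⟨⟨hA.tensorProduct hH, HopfStr.opSmash hHcocomm hop, opSmash_brace hop⟩,
    fun _ _ _ _ => rfl, fun _ _ _ _ => rfl, fun h => h.tensorProduct hHcocomm⟩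

end HopfBraceNL
end
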